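/- arXiv:2507.12086 — 11 statements merged into one kernel-verified Lean document; each statement's English description precedes it below -/
import Mathlib

section
/- Let G be a finite connected simple graph and let v be any vertex of G. Then ⌈(τ(G)+1)/2⌉ ≤ τ_G(v) ≤ τ(G), where τ_G(v) is the detour order of v and τ(G) is the detour order of G. -/
open SimpleGraph

/-- The detour order of a vertex `v`: the maximum number of vertices of a path
in `G` having `v` as an endvertex. -/
noncomputable def vertexDetourOrder {V : Type*} (G : SimpleGraph V) (v : V) : ℕ :=
  sSup {n | ∃ (w : V) (p : G.Walk v w), p.IsPath ∧ n = p.length + 1}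

/-- The detour order of `G`: the maximum number of vertices of a path in `G`. -/
noncomputable def detourOrder {V : Type*} (G : SimpleGraph V) : ℕ :=
  sSup {n | ∃ (u w : V) (p : G.Walk u w), p.IsPath ∧ n = p.length + 1}

theorem aux_reach {V : Type*} (G : SimpleGraph V) (S : Set V) {v x : V} (q : G.Walk v x)
    (hx : x ∈ S) : ∃ y ∈ S, ∃ r : G.Walk v y, ∀ z ∈ r.support, z ∈ S → z = y := by
  induction q with
  | nil => exact ⟨_, hx, SimpleGraph.Walk.nil, by simp⟩
  | @cons a b c h p ih =>
    by_cases ha : a ∈ S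
    · exact ⟨a, ha, SimpleGraph.Walk.nil, by simp⟩
    · obtain ⟨y, hy, r, hr⟩ := ih hx
      refine ⟨y, hy, SimpleGraph.Walk.cons h r, ?_⟩
      intro z hz hzS
      rw [SimpleGraph.Walk.support_cons, List.mem_cons] at hz
      rcases hz with rfl | hz
      · exact absurd hzS ha
      · exact hr z hz hzS

theorem aux_append {V : Type*} (G : SimpleGraph V) {u v w : V} (p : G.Walk u v) (q : G.Walk v w)
    (hp : p.IsPath) (hq : q.IsPath) (h : ∀ z ∈ p.support, z ∈ q.support → z = v) :
    (p.append q).IsPath := by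
  rw [SimpleGraph.Walk.isPath_def] at *
  rw [SimpleGraph.Walk.support_append, List.nodup_append']
  refine ⟨hp, hq.tail, ?_⟩
  intro z hz hz2
  have hzv := h z hz (List.mem_of_mem_tail hz2)
  subst hzv
  rw [SimpleGraph.Walk.support_eq_cons q] at hq
  exact (List.nodup_cons.1 hq).1 hz2

theorem stmt_0 {V : Type*} [Fintype V] (G : SimpleGraph V) (hG : G.Connected) (v : V) :
    (detourOrder G + 2) / 2 ≤ vertexDetourOrder G v ∧
      vertexDetourOrder G v ≤ detourOrder G := by
  classical
  have hbG : BddAbove {n | ∃ (u w : V) (p : G.Walk u w), p.IsPath ∧ n = p.length + 1} := by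
    refine ⟨Fintype.card V, ?_⟩
    rintro n ⟨u, w, p, hp, rfl⟩
    exact hp.length_lt
  have hsub : {n | ∃ (w : V) (p : G.Walk v w), p.IsPath ∧ n = p.length + 1} ⊆
      {n | ∃ (u w : V) (p : G.Walk u w), p.IsPath ∧ n = p.length + 1} := by
    rintro n ⟨w, p, hp, rfl⟩
    exact ⟨v, w, p, hp, rfl⟩
  have hbv := hbG.mono hsub
  have hne : {n | ∃ (w : V) (p : G.Walk v w), p.IsPath ∧ n = p.length + 1}.Nonempty :=
    ⟨_, v, SimpleGraph.Walk.nil, SimpleGraph.Walk.IsPath.nil, rfl⟩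
  refine ⟨?_, csSup_le_csSup hbG hne hsub⟩
  obtain ⟨a, b, P, hP, hL⟩ := Nat.sSup_mem (hne.mono hsub) hbG
  change detourOrder G = _ at hL
  obtain ⟨q0⟩ := hG.preconnected v a
  obtain ⟨y, hy, r, hr⟩ := aux_reach G {z | z ∈ P.support} q0 P.start_mem_support
  have hy' : y ∈ P.support := hy
  have hr' : ∀ z ∈ r.bypass.support, z ∈ P.support → z = y :=
    fun z hz hzP => hr z (r.support_bypass_subset hz) hzP
  have h1 := aux_append G r.bypass (P.dropUntil y hy') r.bypass_isPath (hP.dropUntil hy')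
    (fun z hz hz2 => hr' z hz (P.support_dropUntil_subset hy' hz2))
  have h2 := aux_append G r.bypass (P.takeUntil y hy').reverse r.bypass_isPath
    (hP.takeUntil hy').reverse
    (fun z hz hz2 => hr' z hz (P.support_takeUntil_subset hy' (by simpa using hz2)))
  have e1 : _ ≤ vertexDetourOrder G v := le_csSup hbv ⟨_, _, h1, rfl⟩
  have e2 : _ ≤ vertexDetourOrder G v := le_csSup hbv ⟨_, _, h2, rfl⟩
  have e3 := congrArg SimpleGraph.Walk.length (P.take_spec hy')
  simp only [SimpleGraph.Walk.length_append, SimpleGraph.Walk.length_reverse] at e1 e2 e3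
  omega
end

section
/- Let G be a finite connected simple graph. Then for any two vertices u and v of G, τ_G(u) − τ_G(v) ≤ ⌊τ(G)/2⌋; in particular the maximum gap between consecutive terms of the detour sequence of G is at most ⌊τ(G)/2⌋. -/
open SimpleGraph

/-- A graph is traceable if it has a hamiltonian path, i.e. a path through all vertices. -/
def Traceable {V : Type*} (G : SimpleGraph V) : Prop :=
  ∃ (u w : V) (p : G.Walk u w), p.IsPath ∧ ∀ x, x ∈ p.support

theorem aux_walk {V : Type*} (G : SimpleGraph V) (S : V → Prop) {v a : V} (w : G.Walk v a) (ha : S a) :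
    ∃ (x : V) (q : G.Walk v x), S x ∧ ∀ y ∈ q.support, S y → y = x := by
  induction w with
  | nil => exact ⟨_, Walk.nil, ha, by simp⟩
  | @cons v v' a h p ih =>
    by_cases hv : S v
    · exact ⟨v, Walk.nil, hv, by simp⟩
    · obtain ⟨x, q, hx, hq⟩ := ih ha
      refine ⟨x, Walk.cons h q, hx, ?_⟩
      intro y hy hSy
      rw [Walk.support_cons, List.mem_cons] at hy
      rcases hy with rfl | hy
      · exact absurd hSy hv
      · exact hq y hy hSy

theorem aux_append_s2 {V : Type*} (G : SimpleGraph V) {v x b : V} (q : G.Walk v x) (r : G.Walk x b)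
    (hq : q.IsPath) (hr : r.IsPath) (h : ∀ y ∈ q.support, y ∈ r.support → y = x) :
    (q.append r).IsPath := by
  rw [Walk.isPath_def, Walk.support_append, List.nodup_append]
  have hn := hr.support_nodup
  rw [← Walk.cons_tail_support, List.nodup_cons] at hn
  refine ⟨hq.support_nodup, hn.2, ?_⟩
  rintro y hy z hz rfl
  have := h y hy (List.mem_of_mem_tail hz)
  subst this
  exact hn.1 hz

theorem stmt_2 {V : Type*} [Fintype V] (G : SimpleGraph V) (hG : G.Connected) (u v : V) :
    vertexDetourOrder G u - vertexDetourOrder G v ≤ detourOrder G / 2 := by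
  classical
  have bdd : BddAbove {n | ∃ (u w : V) (p : G.Walk u w), p.IsPath ∧ n = p.length + 1} := by
    refine ⟨Fintype.card V, ?_⟩
    rintro n ⟨a, b, p, hp, rfl⟩
    exact hp.length_lt
  have bddv : ∀ a, BddAbove {n | ∃ (w : V) (p : G.Walk a w), p.IsPath ∧ n = p.length + 1} := by
    intro a
    refine bdd.mono ?_
    rintro n ⟨b, p, hp⟩
    exact ⟨a, b, p, hp⟩
  have hle : vertexDetourOrder G u ≤ detourOrder G := by
    refine csSup_le_csSup bdd ⟨1, u, Walk.nil, by simp⟩ ?_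
    rintro n ⟨b, p, hp⟩
    exact ⟨u, b, p, hp⟩
  have hlen : ∀ (w : V) (p : G.Walk v w), p.IsPath → p.length + 1 ≤ vertexDetourOrder G v :=
    fun w p hp => le_csSup (bddv v) ⟨w, p, hp, rfl⟩
  obtain ⟨a, b, P, hP, hPl⟩ : detourOrder G ∈
      {n | ∃ (u w : V) (p : G.Walk u w), p.IsPath ∧ n = p.length + 1} :=
    Nat.sSup_mem ⟨1, u, u, Walk.nil, by simp⟩ bdd
  obtain ⟨w⟩ := hG.preconnected v a
  obtain ⟨x, q, hx, hq⟩ := aux_walk G (fun y => y ∈ P.support) w P.start_mem_support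
  have hq' : ∀ y ∈ q.bypass.support, y ∈ P.support → y = x :=
    fun y hy => hq y (q.support_bypass_subset hy)
  have h1 := hlen _ _ (aux_append_s2 G q.bypass (P.dropUntil x hx) q.bypass_isPath (hP.dropUntil hx)
    (fun y hy hy' => hq' y hy (P.support_dropUntil_subset hx hy')))
  have h2 := hlen _ _ (aux_append_s2 G q.bypass (P.takeUntil x hx).reverse q.bypass_isPath
    (hP.takeUntil hx).reverse
    (fun y hy hy' => hq' y hy (P.support_takeUntil_subset hx (by simpa using hy'))))
  have h3 := congrArg Walk.length (P.take_spec hx)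
  rw [Walk.length_append] at h1 h2 h3
  rw [Walk.length_reverse] at h2
  omega
end

section
/- Let G be a finite connected simple graph that is not isomorphic to a path graph P_n for any n. Then there exists an integer d such that at least three distinct vertices of G have detour order equal to d (i.e., the detour sequence of G has a repetition of length at least three). -/
open SimpleGraph

theorem vdo_bdd {V : Type*} [Fintype V] (G : SimpleGraph V) (v : V) :
    ∀ n ∈ {n | ∃ (w : V) (p : G.Walk v w), p.IsPath ∧ n = p.length + 1}, n ≤ Fintype.card V := by
  rintro n ⟨w, p, hp, rfl⟩
  exact hp.length_lt

theorem exists_walk_fun {V : Type*} (G : SimpleGraph V) (k : ℕ) : ∀ (g : ℕ → V),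
    (∀ t, t < k → G.Adj (g t) (g (t+1))) →
    ∃ p : G.Walk (g 0) (g k), p.length = k ∧ ∀ t ≤ k, p.getVert t = g t := by
  induction k with
  | zero =>
    intro g _
    refine ⟨Walk.nil, rfl, ?_⟩
    intro t ht
    obtain rfl : t = 0 := by omega
    simp
  | succ k ih =>
    intro g hg
    obtain ⟨p, hp, hp2⟩ := ih (fun t => g (t+1)) (fun t ht => hg (t+1) (by omega))
    refine ⟨Walk.cons (hg 0 (by omega)) p, by simp [hp], ?_⟩
    intro t ht
    cases t with
    | zero => simp
    | succ t => simpa using hp2 t (by omega)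

theorem le_vdo {V : Type*} [Fintype V] (G : SimpleGraph V) (k : ℕ) (g : ℕ → V)
    (hg : ∀ t, t < k → G.Adj (g t) (g (t+1)))
    (hi : ∀ s t, s ≤ k → t ≤ k → g s = g t → s = t) (v : V) (hv : g 0 = v) :
    k + 1 ≤ vertexDetourOrder G v := by
  subst hv
  obtain ⟨p, hp, hp2⟩ := exists_walk_fun G k g hg
  apply le_csSup ⟨_, vdo_bdd G (g 0)⟩
  refine ⟨_, p, ?_, by rw [hp]⟩
  rw [← Walk.IsPath.getVert_injOn_iff]
  intro s hs t ht h
  simp only [Set.mem_setOf_eq, hp] at hs ht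
  rw [hp2 s hs, hp2 t ht] at h
  exact hi s t hs ht h

theorem exists_max {V : Type*} [Fintype V] [Nonempty V] (G : SimpleGraph V) :
    ∃ (n : ℕ) (f : ℕ → V), (∀ t, t < n → G.Adj (f t) (f (t+1))) ∧
      (∀ s t, s ≤ n → t ≤ n → f s = f t → s = t) ∧
      ∀ v, vertexDetourOrder G v ≤ n + 1 := by
  obtain ⟨v, hv⟩ := Finite.exists_max (vertexDetourOrder G)
  obtain ⟨w, p, hp, h⟩ : vertexDetourOrder G v ∈
      {n | ∃ (w : V) (p : G.Walk v w), p.IsPath ∧ n = p.length + 1} :=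
    Nat.sSup_mem ⟨_, v, Walk.nil, by simp, rfl⟩ ⟨_, vdo_bdd G v⟩
  refine ⟨p.length, p.getVert, fun t ht => p.adj_getVert_succ ht, ?_, fun u => h ▸ hv u⟩
  intro s t hs ht h
  exact hp.getVert_injOn hs ht h

theorem chord_bound {V : Type*} [Fintype V] (G : SimpleGraph V) (n : ℕ) (f : ℕ → V)
    (hf : ∀ t, t < n → G.Adj (f t) (f (t+1)))
    (hi : ∀ s t, s ≤ n → t ≤ n → f s = f t → s = t) (i j : ℕ) (hij : i + 2 ≤ j) (hj : j ≤ n)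
    (h : G.Adj (f i) (f j)) : j + 1 ≤ vertexDetourOrder G (f (i+1)) := by
  apply le_vdo G j (fun t => f (if t + i + 1 ≤ j then i + 1 + t else j - t))
  · intro t ht
    by_cases h1 : t + 1 + i + 1 ≤ j
    · have h2 : t + i + 1 ≤ j := by omega
      simp only [h1, h2, if_true]
      exact hf (i+1+t) (by omega)
    · by_cases h2 : t + i + 1 ≤ j
      · simp only [h1, h2, if_true, if_false]
        have e1 : i + 1 + t = j := by omega
        have e2 : j - (t+1) = i := by omega
        rw [e1, e2]; exact h.symm
      · simp only [h1, h2, if_false]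
        have e := hf (j - (t+1)) (by omega)
        have e2 : j - (t+1) + 1 = j - t := by omega
        rw [e2] at e; exact e.symm
  · intro s t hs ht e
    have := hi _ _ (by split_ifs <;> omega) (by split_ifs <;> omega) e
    split_ifs at this <;> omega
  · have : 0 + i + 1 ≤ j := by omega
    simp only [this, if_true]

theorem path_bound {V : Type*} [Fintype V] (G : SimpleGraph V) (n : ℕ) (f : ℕ → V)
    (hf : ∀ t, t < n → G.Adj (f t) (f (t+1)))
    (hi : ∀ s t, s ≤ n → t ≤ n → f s = f t → s = t) (i : ℕ) (hin : i ≤ n) :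
    n - i + 1 ≤ vertexDetourOrder G (f i) := by
  apply le_vdo G (n-i) (fun t => f (i+t))
  · intro t ht; exact hf (i+t) (by omega)
  · intro s t hs ht e
    have := hi _ _ (by omega) (by omega) e
    omega
  · rfl

theorem off_bound {V : Type*} [Fintype V] (G : SimpleGraph V) (n : ℕ) (f : ℕ → V)
    (hf : ∀ t, t < n → G.Adj (f t) (f (t+1)))
    (hi : ∀ s t, s ≤ n → t ≤ n → f s = f t → s = t) (i : ℕ) (hin : i ≤ n) (x : V)
    (hx : ∀ t ≤ n, f t ≠ x) (hxi : G.Adj x (f i)) :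
    n - i + 2 ≤ vertexDetourOrder G x := by
  apply le_vdo G (n-i+1) (fun t => if t = 0 then x else f (i+t-1))
  · intro t ht
    by_cases h0 : t = 0
    · subst h0; simpa using hxi
    · have e := hf (i+t-1) (by omega)
      have e2 : i+t-1+1 = i+(t+1)-1 := by omega
      rw [e2] at e
      simpa [h0] using e
  · intro s t hs ht e
    by_cases h0 : s = 0 <;> by_cases h1 : t = 0
    · omega
    · simp only [h0, h1, if_true, if_false] at e
      exact absurd e.symm (hx _ (by omega))
    · simp only [h0, h1, if_true, if_false] at e
      exact absurd e (hx _ (by omega))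
    · simp only [h0, h1, if_false] at e
      have := hi _ _ (by omega) (by omega) e
      omega
  · simp

theorem stmt_4 {V : Type*} [Fintype V] (G : SimpleGraph V) (hG : G.Connected)
    (hnp : ∀ n : ℕ, IsEmpty (G ≃g pathGraph n)) :
    ∃ d : ℕ, 3 ≤ {v : V | vertexDetourOrder G v = d}.ncard := by
  by_contra! hcon
  have no3 : ∀ (a b c : V), a ≠ b → a ≠ c → b ≠ c →
      vertexDetourOrder G b = vertexDetourOrder G a →
      vertexDetourOrder G c = vertexDetourOrder G a → False := by
    intro a b c hab hac hbc h1 h2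
    have h3 := hcon (vertexDetourOrder G a)
    have h4 : ({a, b, c} : Set V).ncard = 3 := Set.ncard_eq_three.2 ⟨a, b, c, hab, hac, hbc, rfl⟩
    have h5 : ({a, b, c} : Set V) ⊆ {v : V | vertexDetourOrder G v = vertexDetourOrder G a} := by
      rintro x (rfl | rfl | rfl)
      · rfl
      · exact h1
      · exact h2
    have := Set.ncard_le_ncard h5 (Set.toFinite _)
    omega
  haveI := hG.nonempty
  obtain ⟨n, f, hf, hi, hmax⟩ := exists_max G
  -- reversed path
  have hf' : ∀ t, t < n → G.Adj (f (n - t)) (f (n - (t+1))) := by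
    intro t ht
    have e := hf (n - (t+1)) (by omega)
    have e2 : n - (t+1) + 1 = n - t := by omega
    rw [e2] at e; exact e.symm
  have hi' : ∀ s t, s ≤ n → t ≤ n → f (n - s) = f (n - t) → s = t := by
    intro s t hs ht e
    have := hi _ _ (by omega) (by omega) e
    omega
  have lb1 : ∀ i ≤ n, n - i + 1 ≤ vertexDetourOrder G (f i) := path_bound G n f hf hi
  have lb2 : ∀ i ≤ n, i + 1 ≤ vertexDetourOrder G (f i) := by
    intro i hin
    have := path_bound G n (fun t => f (n - t)) hf' hi' (n - i) (by omega)
    have e : n - (n - i) = i := by omega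
    simpa only [e] using this
  have key : ∀ m i, i ≤ n → n - max i (n - i) = m →
      vertexDetourOrder G (f i) = max i (n - i) + 1 := by
    intro m
    induction m using Nat.strong_induction_on with
    | _ m ih =>
      intro i hin hm
      by_contra hne
      have h1 := lb1 i hin
      have h2 := lb2 i hin
      have h3 := hmax (f i)
      obtain ⟨k, hk⟩ : ∃ k, vertexDetourOrder G (f i) = k + 1 := Nat.exists_eq_succ_of_ne_zero (by omega)
      have a1 := ih (n - k) (by omega) k (by omega) (by omega)
      have a2 := ih (n - k) (by omega) (n - k) (by omega) (by omega)
      refine no3 (f i) (f k) (f (n-k)) ?_ ?_ ?_ (by omega) (by omega)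
      · intro e; have := hi _ _ (by omega) (by omega) e; omega
      · intro e; have := hi _ _ (by omega) (by omega) e; omega
      · intro e; have := hi _ _ (by omega) (by omega) e; omega
  have key' : ∀ i, i ≤ n → vertexDetourOrder G (f i) = max i (n - i) + 1 :=
    fun i hin => key _ i hin rfl
  have ham : ∀ x, ∃ t ≤ n, f t = x := by
    by_contra! hx
    obtain ⟨x, hx⟩ := hx
    obtain ⟨p⟩ := hG.preconnected (f 0) x
    obtain ⟨d, -, ⟨i, hin, hd1⟩, hd2⟩ := p.exists_boundary_dart {y | ∃ t ≤ n, f t = y}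
      ⟨0, by omega, rfl⟩ (by rintro ⟨t, ht, e⟩; exact hx t ht e)
    have hadj := d.adj.symm
    rw [← hd1] at hadj
    generalize d.toProd.2 = y at hd2 hadj
    have hy : ∀ t ≤ n, f t ≠ y := fun t ht e => hd2 ⟨t, ht, e⟩
    have b1 := off_bound G n f hf hi i hin y hy hadj
    have b2 := off_bound G n (fun t => f (n - t)) hf' hi' (n - i) (by omega) y
      (fun t ht => hy _ (by omega)) (by
        have e : n - (n - i) = i := by omega
        simpa only [e] using hadj)
    have b3 := hmax y
    obtain ⟨k, hk⟩ : ∃ k, vertexDetourOrder G y = k + 1 := Nat.exists_eq_succ_of_ne_zero (by omega)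
    have a1 := key' k (by omega)
    have a2 := key' (n - k) (by omega)
    refine no3 y (f k) (f (n-k)) (hy _ (by omega)).symm (hy _ (by omega)).symm ?_
      (by omega) (by omega)
    intro e; have := hi _ _ (by omega) (by omega) e; omega
  have nochord : ∀ i j, i + 2 ≤ j → j ≤ n → ¬ G.Adj (f i) (f j) := by
    intro i j hij hj h
    have c1 := chord_bound G n f hf hi i j hij hj h
    have c2 := chord_bound G n (fun t => f (n - t)) hf' hi' (n - j) (n - i) (by omega) (by omega)
      (by
        have e : n - (n - i) = i := by omega
        have e' : n - (n - j) = j := by omega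
        simpa only [e, e'] using h.symm)
    have e : n - (n - j + 1) = j - 1 := by omega
    simp only [e] at c2
    rw [key' _ (by omega)] at c1 c2
    omega
  let φ : Fin (n+1) → V := fun t => f t
  have hφ : Function.Bijective φ := by
    constructor
    · intro s t h
      exact Fin.ext (hi _ _ (by omega) (by omega) h)
    · intro x
      obtain ⟨t, ht, e⟩ := ham x
      exact ⟨⟨t, by omega⟩, e⟩
  have iso : pathGraph (n+1) ≃g G := 
    { toEquiv := Equiv.ofBijective φ hφ
      map_rel_iff' := by
        intro a b
        change G.Adj (f a) (f b) ↔ _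
        rw [pathGraph_adj]
        constructor
        · intro h
          have h0 : a.val ≠ b.val := by
            intro e; rw [e] at h; exact G.loopless.irrefl _ h
          by_contra hc
          rcases lt_or_gt_of_ne h0 with h1 | h1
          · exact nochord a b (by omega) (by omega) h
          · exact nochord b a (by omega) (by omega) h.symm
        · rintro (h | h)
          · rw [← h]; exact hf _ (by omega)
          · rw [← h]; exact (hf _ (by omega)).symm }
  exact (hnp (n+1)).false iso.symm
end

section
/- Let T be a finite tree with detour order τ(T) = m ≥ 3, and let a = ⌈(m+1)/2⌉. Then: (1) the set of detour orders of vertices of T is exactly {a, a+1, …, m}; (2) the number of vertices of T with detour order a equals 1 if m is odd and 2 if m is even; and (3) for every integer j with a < j ≤ m, at least two vertices of T have detour order j. -/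
open SimpleGraph

theorem path_len {V : Type*} {G : SimpleGraph V} (hT : G.IsTree) {u w : V} (p : G.Walk u w)
    (hp : p.IsPath) : p.length = G.dist u w := by
  obtain ⟨q, hq, hl⟩ := hT.1.exists_path_of_dist u w
  rw [← hl]
  have := hT.2.path_unique ⟨p, hp⟩ ⟨q, hq⟩
  rw [Subtype.ext_iff] at this
  exact congrArg _ this

theorem append_path {V : Type*} {G : SimpleGraph V} {u v w : V} (p : G.Walk u v) (q : G.Walk v w)
    (hp : p.IsPath) (hq : q.IsPath) (h : ∀ x ∈ p.support, x ∈ q.support → x = v) :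
    (p.append q).IsPath := by
  rw [Walk.isPath_def, Walk.support_append, List.nodup_append]
  refine ⟨hp.support_nodup, hq.support_nodup.tail, ?_⟩
  rintro a ha b hb rfl
  have h1 := h a ha (List.mem_of_mem_tail hb)
  subst h1
  have h2 := hq.support_nodup
  rw [Walk.support_eq_cons] at h2
  exact (List.nodup_cons.1 h2).1 hb

theorem gate {V : Type*} {G : SimpleGraph V} (hT : G.IsTree) {u w : V} (p : G.Walk u w)
    (hp : p.IsPath) (x : V) : ∃ i ≤ p.length,
      G.dist x u = G.dist x (p.getVert i) + i ∧
      G.dist x w = G.dist x (p.getVert i) + (p.length - i) := by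
  classical
  obtain ⟨i, hi, hmin⟩ := Finset.exists_min_image (Finset.range (p.length + 1))
    (fun i => G.dist x (p.getVert i)) ⟨0, by simp⟩
  simp only [Finset.mem_range, Nat.lt_succ_iff] at hi hmin
  refine ⟨i, hi, ?_⟩
  obtain ⟨q, hq, hl⟩ := hT.1.exists_path_of_dist x (p.getVert i)
  have key : ∀ y ∈ q.support, y ∈ p.support → y = p.getVert i := by
    intro y hy hyp
    obtain ⟨k, rfl, hk⟩ := Walk.mem_support_iff_exists_getVert.1 hyp
    have h1 := hmin k hk
    have h2 := SimpleGraph.dist_le (q.takeUntil _ hy)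
    have h3 := congrArg Walk.length (q.take_spec hy)
    rw [Walk.length_append] at h3
    exact Walk.eq_of_length_eq_zero (p := q.dropUntil _ hy) (by omega)
  constructor
  · have h1 := append_path q (p.take i).reverse hq (hp.take i).reverse (by
      intro y hy hy'
      rw [Walk.support_reverse, List.mem_reverse] at hy'
      exact key y hy ((p.isSubwalk_take i).support_subset hy'))
    have h2 := path_len hT _ h1
    rw [Walk.length_append, Walk.length_reverse, Walk.take_length] at h2
    omega
  · have h1 := append_path q (p.drop i) hq (hp.drop i) (by
      intro y hy hy'
      exact key y hy ((p.isSubwalk_drop i).support_subset hy'))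
    have h2 := path_len hT _ h1
    rw [Walk.length_append, Walk.drop_length] at h2
    omega

theorem dist_getVert_le {V : Type*} {G : SimpleGraph V} {u w : V} (p : G.Walk u w)
    (i j : ℕ) (hij : i ≤ j) (hj : j ≤ p.length) :
    G.dist (p.getVert i) (p.getVert j) ≤ j - i := by
  have h := SimpleGraph.dist_le ((p.take j).drop i)
  rw [Walk.drop_length, Walk.take_length, Walk.take_getVert, min_eq_right hij,
    min_eq_left hj] at h
  exact h

theorem ecc_eq {V : Type*} {G : SimpleGraph V} (hT : G.IsTree) {u w : V} (p : G.Walk u w)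
    (hp : p.IsPath) (hmax : ∀ x y, G.dist x y ≤ p.length) (x : V) :
    vertexDetourOrder G x = max (G.dist x u) (G.dist x w) + 1 := by
  apply IsGreatest.csSup_eq
  constructor
  · rcases max_cases (G.dist x u) (G.dist x w) with h | h
    · obtain ⟨q, hq, hl⟩ := hT.1.exists_path_of_dist x u
      exact ⟨u, q, hq, by omega⟩
    · obtain ⟨q, hq, hl⟩ := hT.1.exists_path_of_dist x w
      exact ⟨w, q, hq, by omega⟩
  · rintro n ⟨y, q, hq, rfl⟩
    rw [path_len hT q hq]
    obtain ⟨i, hi, h1, h2⟩ := gate hT p hp x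
    obtain ⟨k, hk, h3, h4⟩ := gate hT p hp y
    have h5 := hmax y u
    have h6 := hmax y w
    have t1 := hT.1.dist_triangle (u := x) (v := p.getVert i) (w := y)
    have t2 := hT.1.dist_triangle (u := p.getVert i) (v := p.getVert k) (w := y)
    rw [SimpleGraph.dist_comm (u := p.getVert k)] at t2
    rcases le_total i k with h | h
    · have := dist_getVert_le p i k h hk
      omega
    · have := dist_getVert_le p k i h hi
      rw [SimpleGraph.dist_comm] at this
      omega

theorem stmt_5 {V : Type*} [Fintype V] (G : SimpleGraph V) (hT : G.IsTree)
    (m : ℕ) (hm : 3 ≤ m) (hτ : detourOrder G = m) :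
    Set.range (vertexDetourOrder G) = Set.Icc ((m + 2) / 2) m ∧
    {v : V | vertexDetourOrder G v = (m + 2) / 2}.ncard = (if Odd m then 1 else 2) ∧
    ∀ j : ℕ, (m + 2) / 2 < j → j ≤ m →
      2 ≤ {v : V | vertexDetourOrder G v = j}.ncard := by
  classical
  have hne : Nonempty V := hT.1.nonempty
  have hmem : detourOrder G ∈ {n | ∃ (u w : V) (p : G.Walk u w), p.IsPath ∧ n = p.length + 1} := by
    apply Nat.sSup_mem
    · obtain ⟨v⟩ := hne
      exact ⟨_, v, v, Walk.nil, Walk.IsPath.nil, rfl⟩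
    · refine ⟨Fintype.card V, ?_⟩
      rintro n ⟨u, w, p, hp, rfl⟩
      exact hp.length_lt
  have hub : ∀ x y, G.dist x y + 1 ≤ m := by
    intro x y
    obtain ⟨q, hq, hl⟩ := hT.1.exists_path_of_dist x y
    rw [← hτ]
    apply le_csSup
    · refine ⟨Fintype.card V, ?_⟩
      rintro n ⟨u, w, p, hp, rfl⟩
      exact hp.length_lt
    · exact ⟨x, y, q, hq, by omega⟩
  rw [hτ] at hmem
  obtain ⟨u, w, p, hp, hpm⟩ := hmem
  have hecc := ecc_eq hT p hp (fun x y => by have := hub x y; omega)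
  have hP : ∀ i ≤ p.length, vertexDetourOrder G (p.getVert i) = max i (p.length - i) + 1 := by
    intro i hi
    have h1 := path_len hT _ (hp.take i)
    have h2 := path_len hT _ (hp.drop i)
    rw [Walk.take_length, SimpleGraph.dist_comm] at h1
    rw [Walk.drop_length] at h2
    rw [hecc]
    omega
  have hinj : ∀ i ≤ p.length, ∀ j ≤ p.length, i ≠ j → p.getVert i ≠ p.getVert j :=
    fun i hi j hj hij h => hij (hp.getVert_injOn hi hj h)
  have hall : ∀ x, ∃ i ≤ p.length,
      vertexDetourOrder G x = G.dist x (p.getVert i) + max i (p.length - i) + 1 := by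
    intro x
    obtain ⟨i, hi, h1, h2⟩ := gate hT p hp x
    exact ⟨i, hi, by rw [hecc]; omega⟩
  refine ⟨?_, ?_, ?_⟩
  · ext j
    simp only [Set.mem_range, Set.mem_Icc]
    constructor
    · rintro ⟨x, rfl⟩
      constructor
      · obtain ⟨i, hi, h⟩ := hall x
        omega
      · rw [hecc]
        have := hub x u
        have := hub x w
        omega
    · rintro ⟨h1, h2⟩
      exact ⟨p.getVert (j - 1), by rw [hP _ (by omega)]; omega⟩
  · have hchar : {v : V | vertexDetourOrder G v = (m + 2) / 2} =
        {p.getVert (p.length / 2), p.getVert ((p.length + 1) / 2)} := by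
      ext x
      simp only [Set.mem_setOf_eq, Set.mem_insert_iff, Set.mem_singleton_iff]
      constructor
      · intro hx
        obtain ⟨i, hi, h⟩ := hall x
        have h0 : G.dist x (p.getVert i) = 0 := by omega
        rw [hT.1.dist_eq_zero_iff] at h0
        have : i = p.length / 2 ∨ i = (p.length + 1) / 2 := by omega
        rcases this with rfl | rfl
        · exact Or.inl h0
        · exact Or.inr h0
      · rintro (rfl | rfl)
        · rw [hP _ (by omega)]; omega
        · rw [hP _ (by omega)]; omega
    rw [hchar]
    split_ifs with ho
    · obtain ⟨k, hk⟩ := ho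
      rw [show (p.length + 1) / 2 = p.length / 2 by omega]
      simp
    · rw [Nat.not_odd_iff_even] at ho
      obtain ⟨k, hk⟩ := ho
      exact Set.ncard_pair (hinj _ (by omega) _ (by omega) (by omega))
  · intro j hj1 hj2
    rw [← Set.ncard_pair (hinj (j - 1) (by omega) (p.length - (j - 1)) (by omega) (by omega))]
    apply Set.ncard_le_ncard _ (Set.toFinite _)
    rintro x (rfl | rfl)
    · change vertexDetourOrder G _ = j
      rw [hP _ (by omega)]; omega
    · change vertexDetourOrder G _ = j
      rw [hP _ (by omega)]; omega
end

section
/- Let m ≥ 3 be an integer, let a = ⌈(m+1)/2⌉, and for each integer j with a < j ≤ m let k_j ≥ 2 be an integer. Then there exists a finite tree T with detour order τ(T) = m such that the number of vertices of T with detour order a equals 1 if m is odd and 2 if m is even, and for each j with a < j ≤ m the number of vertices of T with detour order j equals k_j. -/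
open SimpleGraph

abbrev CatV (m : ℕ) (c : ℕ → ℕ) : Type := Σ i : Fin m, Fin (c i.val + 1)

def catG (m : ℕ) (c : ℕ → ℕ) : SimpleGraph (CatV m c) where
  Adj u v := (u.1.val = v.1.val + 1 ∧ v.2.val = 0) ∨ (v.1.val = u.1.val + 1 ∧ u.2.val = 0)
  symm := ⟨fun _ _ h => h.symm⟩
  loopless := ⟨fun u h => by omega⟩

def spn {m : ℕ} (c : ℕ → ℕ) (i : ℕ) (h : i < m) : CatV m c := ⟨⟨i, h⟩, 0⟩

theorem eq_spn {m : ℕ} {c : ℕ → ℕ} (v : CatV m c) (h : v.2.val = 0) {t : ℕ} (ht : t < m)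
    (e : v.1.val = t) : v = spn c t ht := by
  obtain ⟨⟨i, hi⟩, n⟩ := v
  simp only at e h
  subst e
  have : n = 0 := Fin.ext h
  subst this
  rfl

theorem walk_down {m : ℕ} {c : ℕ → ℕ} (t : ℕ) (ht : t < m) : ∀ (d : ℕ) (v : CatV m c),
    v.1.val = t + d → (d = 0 → v.2.val = 0) →
    ∃ p : (catG m c).Walk v (spn c t ht), p.length = d := by
  intro d
  induction d with
  | zero =>
    intro v e h
    have := eq_spn v (h rfl) ht e
    subst this
    exact ⟨.nil, rfl⟩
  | succ d ih =>
    intro v e _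
    have hv := v.1.isLt
    obtain ⟨p, hp⟩ := ih (spn c (t + d) (by omega)) rfl (fun _ => rfl)
    have hadj : (catG m c).Adj v (spn c (t + d) (by omega)) := Or.inl ⟨by simp [spn]; omega, rfl⟩
    exact ⟨.cons hadj p, by simp [hp]⟩

theorem lev_walk {m : ℕ} {c : ℕ → ℕ} {u v : CatV m c} (p : (catG m c).Walk u v) :
    u.1.val ≤ v.1.val + p.length ∧ v.1.val ≤ u.1.val + p.length := by
  induction p with
  | nil => simp
  | cons h p ih =>
    simp only [Walk.length_cons]
    rcases h with h | h <;> omega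

theorem cat_conn {m : ℕ} (c : ℕ → ℕ) (hm : 0 < m) (h0 : c 0 = 0) : (catG m c).Connected := by
  have key : ∀ v : CatV m c, (catG m c).Reachable v (spn c 0 hm) := by
    intro v
    obtain ⟨p, -⟩ := walk_down 0 hm v.1.val v (by omega) (by
      intro h
      have := v.2.isLt
      have h3 : c v.1.val = 0 := by rw [h, h0]
      omega)
    exact ⟨p⟩
  haveI : Nonempty (CatV m c) := ⟨spn c 0 hm⟩
  exact ⟨fun u v => (key u).trans (key v).symm⟩

theorem cat_tree {m : ℕ} (c : ℕ → ℕ) (hm : 0 < m) (h0 : c 0 = 0) : (catG m c).IsTree := by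
  have hc := cat_conn c hm h0
  rw [isTree_iff_connected_and_card]
  refine ⟨hc, le_antisymm ?_ hc.card_vert_le_card_edgeSet_add_one⟩
  have hsub : (catG m c).edgeSet ⊆
      (fun v : CatV m c => s(v, spn c (v.1.val - 1) (by have := v.1.isLt; omega))) ''
        ({spn c 0 hm}ᶜ : Set (CatV m c)) := by
    intro e
    induction e with
    | h u v =>
      intro h
      have main : ∀ u v : CatV m c, (u.1.val = v.1.val + 1 ∧ v.2.val = 0) → 
          u ≠ spn c 0 hm ∧ ∀ h, spn c (u.1.val - 1) h = v := by
        rintro u v ⟨h1, h2⟩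
        refine ⟨?_, fun h => (eq_spn v h2 h (by omega)).symm⟩
        rintro rfl
        simp [spn] at h1
      rcases h with h | h
      · exact ⟨u, (main _ _ h).1, by simp only [(main _ _ h).2]⟩
      · exact ⟨v, (main _ _ h).1, by simp only [(main _ _ h).2]; exact Sym2.eq_swap⟩
  have h1 := (Set.ncard_le_ncard hsub (Set.toFinite _)).trans (Set.ncard_image_le (Set.toFinite _))
  have h2 := Set.ncard_add_ncard_compl ({spn c 0 hm} : Set (CatV m c))
  rw [Set.ncard_singleton] at h2
  rw [Nat.card_coe_set_eq]
  omega

theorem path_le {V : Type*} {G : SimpleGraph V} (hG : G.IsTree) {u v : V} (p q : G.Walk u v)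
    (hp : p.IsPath) : p.length ≤ q.length := by
  classical
  have := hG.2.path_unique ⟨p, hp⟩ q.toPath
  have h : p = q.bypass := congrArg Subtype.val this
  rw [h]
  exact q.length_bypass_le

theorem walk_ub {m : ℕ} {c : ℕ → ℕ} (hm : 3 ≤ m) (hc : ∀ i, i < (m + 2) / 2 → c i = 0)
    (u v : CatV m c) :
    ∃ p : (catG m c).Walk u v, p.length + 1 ≤ max (u.1.val + 1) (m - u.1.val) := by
  have hu := u.1.isLt
  have hv := v.1.isLt
  have key : ∀ u : CatV m c, u.2.val ≠ 0 → (m + 2) / 2 ≤ u.1.val := by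
    intro u h
    by_contra hlt
    have h1 := u.2.isLt
    have h3 := hc u.1.val (by omega)
    omega
  by_cases h1 : u.2.val = 0 ∧ u.1.val ≤ v.1.val ∧ (u.1.val = v.1.val → v.2.val = 0)
  · obtain ⟨p, hp⟩ := walk_down u.1.val hu (v.1.val - u.1.val) v (by omega) (by
      intro h; exact h1.2.2 (by omega))
    have e := eq_spn u h1.1 hu rfl
    exact ⟨p.reverse.copy e.symm rfl, by rw [Walk.length_copy, Walk.length_reverse, hp]; omega⟩
  by_cases h2 : v.2.val = 0 ∧ v.1.val ≤ u.1.val ∧ (v.1.val = u.1.val → u.2.val = 0)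
  · obtain ⟨p, hp⟩ := walk_down v.1.val hv (u.1.val - v.1.val) u (by omega) (by
      intro h; exact h2.2.2 (by omega))
    have e := eq_spn v h2.1 hv rfl
    exact ⟨p.copy rfl e.symm, by rw [Walk.length_copy, hp]; omega⟩
  by_cases h3 : u.1.val ≤ v.1.val
  · have : u.2.val ≠ 0 ∨ v.2.val ≠ 0 := by omega
    have hk : (m + 2) / 2 ≤ u.1.val := by
      by_cases hu0 : u.2.val = 0
      · have := key v (by omega)
        omega
      · exact key u hu0
    obtain ⟨p, hp⟩ := walk_down (u.1.val - 1) (by omega) 1 u (by omega) (by omega)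
    obtain ⟨q, hq⟩ := walk_down (u.1.val - 1) (by omega) (v.1.val - u.1.val + 1) v (by omega)
      (by omega)
    exact ⟨p.append q.reverse, by simp [hp, hq]; omega⟩
  · have hk := key v (by omega)
    obtain ⟨p, hp⟩ := walk_down (v.1.val - 1) (by omega) (u.1.val - v.1.val + 1) u (by omega) 
      (by omega)
    obtain ⟨q, hq⟩ := walk_down (v.1.val - 1) (by omega) 1 v (by omega) (by omega)
    exact ⟨p.append q.reverse, by simp [hp, hq]; omega⟩

theorem exists_path {m : ℕ} {c : ℕ → ℕ} (hm : 3 ≤ m) (hc : ∀ i, i < (m + 2) / 2 → c i = 0)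
    (u : CatV m c) :
    ∃ (w : CatV m c) (p : (catG m c).Walk u w), p.IsPath ∧
      max (u.1.val + 1) (m - u.1.val) = p.length + 1 := by
  classical
  have hT := cat_tree c (by omega : 0 < m) (hc 0 (by omega))
  have aux : ∀ w : CatV m c, (max (u.1.val + 1) (m - u.1.val) ≤ u.1.val - w.1.val + 1 ∨
      max (u.1.val + 1) (m - u.1.val) ≤ w.1.val - u.1.val + 1) →
      ∃ (p : (catG m c).Walk u w), p.IsPath ∧
      max (u.1.val + 1) (m - u.1.val) = p.length + 1 := by
    intro w hw
    obtain ⟨q, hq⟩ := walk_ub hm hc u w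
    have h1 := q.length_bypass_le
    have h2 := lev_walk q.bypass
    exact ⟨q.bypass, q.bypass_isPath, by omega⟩
  have hu := u.1.isLt
  rcases le_total (u.1.val + 1) (m - u.1.val) with h | h
  · exact ⟨_, aux (spn c (m - 1) (by omega)) (Or.inr (by simp only [spn]; omega))⟩
  · exact ⟨_, aux (spn c 0 (by omega)) (Or.inl (by simp only [spn]; omega))⟩

theorem path_ub {m : ℕ} {c : ℕ → ℕ} (hm : 3 ≤ m) (hc : ∀ i, i < (m + 2) / 2 → c i = 0)
    (u v : CatV m c) (p : (catG m c).Walk u v) (hp : p.IsPath) :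
    p.length + 1 ≤ max (u.1.val + 1) (m - u.1.val) := by
  obtain ⟨q, hq⟩ := walk_ub hm hc u v
  have := path_le (cat_tree c (by omega : 0 < m) (hc 0 (by omega))) p q hp
  omega

theorem cat_vdo {m : ℕ} {c : ℕ → ℕ} (hm : 3 ≤ m) (hc : ∀ i, i < (m + 2) / 2 → c i = 0)
    (u : CatV m c) : vertexDetourOrder (catG m c) u = max (u.1.val + 1) (m - u.1.val) := by
  refine IsGreatest.csSup_eq ⟨exists_path hm hc u, ?_⟩
  rintro n ⟨w, p, hp, rfl⟩
  exact path_ub hm hc u w p hp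

theorem cat_do {m : ℕ} {c : ℕ → ℕ} (hm : 3 ≤ m) (hc : ∀ i, i < (m + 2) / 2 → c i = 0) :
    detourOrder (catG m c) = m := by
  refine IsGreatest.csSup_eq ⟨?_, ?_⟩
  · obtain ⟨w, p, hp, h⟩ := exists_path hm hc (spn c 0 (by omega))
    refine ⟨_, w, p, hp, ?_⟩
    rw [← h]
    simp only [spn]
    omega
  · rintro n ⟨u, w, p, hp, rfl⟩
    have := path_ub hm hc u w p hp
    have := u.1.isLt
    omega

theorem fiber_card {m : ℕ} {c : ℕ → ℕ} (i : ℕ) (hi : i < m) :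
    {v : CatV m c | v.1.val = i}.ncard = c i + 1 := by
  have : {v : CatV m c | v.1.val = i} =
      Set.range (Sigma.mk (β := fun i : Fin m => Fin (c i.val + 1)) ⟨i, hi⟩) := by
    ext ⟨⟨j, hj⟩, n⟩
    simp only [Set.mem_setOf_eq, Set.mem_range]
    constructor
    · rintro rfl
      exact ⟨n, rfl⟩
    · rintro ⟨y, hy⟩
      have := congrArg (fun v : CatV m c => v.1.val) hy
      exact this.symm
  rw [this, ← Set.image_univ, Set.ncard_image_of_injective _ sigma_mk_injective, Set.ncard_univ]
  simp

theorem fiber2_card {m : ℕ} {c : ℕ → ℕ} (i j : ℕ) (hi : i < m) (hj : j < m) (hij : i ≠ j) :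
    {v : CatV m c | v.1.val = i ∨ v.1.val = j}.ncard = c i + 1 + (c j + 1) := by
  rw [Set.setOf_or, Set.ncard_union_eq ?_ (Set.toFinite _) (Set.toFinite _), fiber_card i hi,
    fiber_card j hj]
  rw [Set.disjoint_left]
  intro v h1 h2
  exact hij (h1.symm.trans h2)

theorem stmt_6 (m : ℕ) (hm : 3 ≤ m) (k : ℕ → ℕ)
    (hk : ∀ j : ℕ, (m + 2) / 2 < j → j ≤ m → 2 ≤ k j) :
    ∃ (V : Type) (_ : Fintype V) (G : SimpleGraph V),
      G.IsTree ∧ detourOrder G = m ∧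
      {v : V | vertexDetourOrder G v = (m + 2) / 2}.ncard = (if Odd m then 1 else 2) ∧
      ∀ j : ℕ, (m + 2) / 2 < j → j ≤ m →
        {v : V | vertexDetourOrder G v = j}.ncard = k j := by
  obtain ⟨c, hcdef⟩ : ∃ c : ℕ → ℕ, c = fun i => if i < (m + 2) / 2 then 0 else k (i + 1) - 2 :=
    ⟨_, rfl⟩
  have hc : ∀ i, i < (m + 2) / 2 → c i = 0 := by
    intro i hi
    simp only [hcdef, hi, if_true, if_false]
  have hc' : ∀ i, ¬ i < (m + 2) / 2 → c i = k (i + 1) - 2 := by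
    intro i hi
    simp only [hcdef, hi, if_true, if_false]
  have hset : ∀ j, (m + 2) / 2 ≤ j → j ≤ m →
      {v : CatV m c | vertexDetourOrder (catG m c) v = j} =
      {v : CatV m c | v.1.val = j - 1 ∨ v.1.val = m - j} := by
    intro j h1 h2
    ext v
    have := v.1.isLt
    simp only [Set.mem_setOf_eq, cat_vdo hm hc]
    omega
  refine ⟨CatV m c, inferInstance, catG m c, cat_tree c (by omega) (hc 0 (by omega)),
    cat_do hm hc, ?_, ?_⟩
  · rw [hset _ le_rfl (by omega)]
    split_ifs with ho
    · obtain ⟨r, rfl⟩ := ho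
      have e1 : (2 * r + 1 + 2) / 2 - 1 = r := by omega
      have e2 : 2 * r + 1 - (2 * r + 1 + 2) / 2 = r := by omega
      simp only [e1, e2, or_self]
      rw [fiber_card r (by omega), hc r (by omega)]
    · rw [Nat.not_odd_iff_even] at ho
      obtain ⟨r, rfl⟩ := ho
      rw [fiber2_card _ _ (by omega) (by omega) (by omega), hc _ (by omega), hc _ (by omega)]
  · intro j h1 h2
    rw [hset j h1.le h2, fiber2_card _ _ (by omega) (by omega) (by omega), hc' (j - 1) (by omega),
      hc (m - j) (by omega)]
    have := hk j h1 h2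
    rw [show j - 1 + 1 = j by omega]
    omega
end

section
/- Let G be a finite connected simple graph containing exactly one cycle (a unicyclic graph). Then the detour sequence of G is full: for every integer t with min_{v∈V(G)} τ_G(v) ≤ t ≤ τ(G), there exists a vertex u of G with detour order τ_G(u) = t. -/
open SimpleGraph

lemma aux_bdd {V : Type*} [Fintype V] (G : SimpleGraph V) (v : V) :
    BddAbove {n | ∃ (w : V) (p : G.Walk v w), p.IsPath ∧ n = p.length + 1} := by
  refine ⟨Fintype.card V, ?_⟩
  rintro n ⟨w, p, hp, rfl⟩
  exact hp.length_lt

lemma aux_le {V : Type*} [Fintype V] (G : SimpleGraph V) {v w : V} (p : G.Walk v w)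
    (hp : p.IsPath) : p.length + 1 ≤ vertexDetourOrder G v :=
  le_csSup (aux_bdd G v) ⟨w, p, hp, rfl⟩

lemma aux_ex {V : Type*} [Fintype V] (G : SimpleGraph V) (v : V) :
    ∃ (w : V) (p : G.Walk v w), p.IsPath ∧ vertexDetourOrder G v = p.length + 1 :=
  Nat.sSup_mem (s := {n | ∃ (w : V) (p : G.Walk v w), p.IsPath ∧ n = p.length + 1})
    ⟨1, v, Walk.nil, by simp, by simp⟩ (aux_bdd G v)

lemma aux_ex_max {V : Type*} [Fintype V] (G : SimpleGraph V) (v : V) :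
    ∃ u : V, detourOrder G ≤ vertexDetourOrder G u := by
  obtain ⟨u, w, p, hp, h⟩ := Nat.sSup_mem
    (s := {n | ∃ (u w : V) (p : G.Walk u w), p.IsPath ∧ n = p.length + 1})
    ⟨1, v, v, Walk.nil, by simp, by simp⟩
    ⟨Fintype.card V, by rintro n ⟨u, w, p, hp, rfl⟩; exact hp.length_lt⟩
  exact ⟨u, (show detourOrder G = _ from h) ▸ aux_le G p hp⟩

/-- If the detour order jumps along an edge `uv`, a longest path from `u` splits at `v`. -/
lemma aux_jump {V : Type*} [Fintype V] (G : SimpleGraph V) {u v : V} (h : G.Adj v u)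
    (hj : vertexDetourOrder G v + 2 ≤ vertexDetourOrder G u) :
    ∃ (w : V) (q : G.Walk u v) (r : G.Walk v w), (q.append r).IsPath ∧
      vertexDetourOrder G u = (q.append r).length + 1 ∧ (Walk.cons h q).IsCycle ∧
      s(v, u) ∉ r.edges := by
  classical
  obtain ⟨w, p, hp, hl⟩ := aux_ex G u
  have hv : v ∈ p.support := by
    by_contra hv
    have := aux_le G (Walk.cons h p) (hp.cons hv)
    simp at this
    omega
  have he : s(v, u) ∉ p.edges := by
    cases p with
    | nil => simp
    | @cons _ x _ hx p' =>
      rw [Walk.cons_isPath_iff] at hp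
      intro hmem
      rw [Walk.edges_cons, List.mem_cons] at hmem
      rcases hmem with hmem | hmem
      · have hxv : v = x := by
          have := h.ne
          simp only [Sym2.eq_iff] at hmem
          rcases hmem with ⟨a, b⟩ | ⟨a, b⟩
          · exact absurd a this
          · exact a
        subst hxv
        have := aux_le G p' hp.1
        simp at hl
        omega
      · exact hp.2 (Walk.snd_mem_support_of_mem_edges _ hmem)
  refine ⟨w, p.takeUntil v hv, p.dropUntil v hv, ?_, ?_, ?_, ?_⟩
  · rwa [Walk.take_spec]
  · rwa [Walk.take_spec]
  · rw [Walk.cons_isCycle_iff]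
    exact ⟨hp.takeUntil hv, fun hm => he (Walk.edges_takeUntil_subset_edges _ hv hm)⟩
  · exact fun hm => he (Walk.edges_dropUntil_subset_edges _ hv hm)

theorem stmt_7 {V : Type*} [Fintype V] (G : SimpleGraph V) (hG : G.Connected)
    (hcyc : ∃ (v : V) (c : G.Walk v v), c.IsCycle)
    (huniq : ∀ (u v : V) (c : G.Walk u u) (d : G.Walk v v), c.IsCycle → d.IsCycle →
      {e | e ∈ c.edges} = {e | e ∈ d.edges}) :
    ∀ t : ℕ, (∃ v : V, vertexDetourOrder G v ≤ t) → t ≤ detourOrder G →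
      ∃ u : V, vertexDetourOrder G u = t := by
  rintro t ⟨m, hm⟩ ht
  by_contra! hne
  obtain ⟨M, hM⟩ := aux_ex_max G m
  -- every walk from low to high has a jump
  have key : ∀ {a b : V} (p : G.Walk a b), vertexDetourOrder G a ≤ t →
      t ≤ vertexDetourOrder G b → ∃ d ∈ p.darts, vertexDetourOrder G d.fst < t ∧
        t < vertexDetourOrder G d.snd := by
    intro a b p ha hb
    obtain ⟨d, hd, h1, h2⟩ := p.exists_boundary_dart {x | vertexDetourOrder G x ≤ t} ha
      (by have := hne b; simp; omega)
    simp at h1 h2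
    have := hne d.fst
    exact ⟨d, hd, by omega, h2⟩
  obtain ⟨p⟩ := hG.preconnected m M
  obtain ⟨d, -, h1, h2⟩ := key p hm (ht.trans hM)
  obtain ⟨w, q, r, hp, hl, hc, he⟩ := aux_jump G d.adj (by omega)
  have hw := aux_le G (q.append r).reverse hp.reverse
  rw [Walk.length_reverse] at hw
  obtain ⟨d', hd', h1', h2'⟩ := key r h1.le (by omega)
  obtain ⟨w', q', r', hp', hl', hc', he'⟩ := aux_jump G d'.adj (by omega)
  have hin : s(d'.fst, d'.snd) ∈ r.edges := List.mem_map.2 ⟨d', hd', rfl⟩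
  have hset := huniq _ _ _ _ hc hc'
  have hmem : s(d'.fst, d'.snd) ∈ (Walk.cons d.adj q).edges := by
    have : s(d'.fst, d'.snd) ∈ {e | e ∈ (Walk.cons d'.adj q').edges} := by simp
    rw [← hset] at this
    exact this
  rw [Walk.edges_cons, List.mem_cons] at hmem
  rcases hmem with hmem | hmem
  · exact he (hmem ▸ hin)
  · have hnd := hp.isTrail.edges_nodup
    rw [Walk.edges_append, List.nodup_append] at hnd
    exact hnd.2.2 _ hmem _ hin rfl
end

section
/- Let G = K(n_1, n_2, …, n_p) be the complete multipartite graph with p ≥ 2 parts of sizes 0 ≤ n_1 ≤ n_2 ≤ … ≤ n_p, and let N = n_1 + n_2 + … + n_p. Then: (a) if 2n_p ≤ N, every vertex of G has detour order N (so the detour sequence of G is (N)_N); (b) if 2n_p > N, every vertex in the part of size n_p has detour order 2(N − n_p) + 1 and every other vertex has detour order 2(N − n_p). -/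
open SimpleGraph

open Finset in
theorem aux_path {V ι : Type*} [DecidableEq V] [DecidableEq ι] (G : SimpleGraph V) (c : V → ι)
    (hG : ∀ u v, c u ≠ c v → G.Adj u v) (m : ℕ) : ∀ (R : Finset V) (v : V), R.card = m → v ∉ R →
    (∀ i, 2 * (R.filter (fun x => c x = i)).card ≤ R.card + 1) →
    2 * (R.filter (fun x => c x = c v)).card ≤ R.card →
    ∃ (w : V) (q : G.Walk v w), q.IsPath ∧ (∀ x ∈ q.support, x = v ∨ x ∈ R) ∧ q.length = m := by
  induction m with
  | zero =>
    intro R v hR hv _ _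
    exact ⟨v, Walk.nil, by simp, by simp, rfl⟩
  | succ m ih =>
    intro R v hR hv h1 h2
    have key : ∃ u ∈ R, c u ≠ c v ∧
        ∀ i, i ≠ c u → 2 * (R.filter (fun x => c x = i)).card ≤ R.card := by
      by_cases hb : ∃ b, R.card < 2 * (R.filter (fun x => c x = b)).card
      · obtain ⟨b, hb⟩ := hb
        have hpos : 0 < (R.filter (fun x => c x = b)).card := by omega
        obtain ⟨u, hu⟩ := Finset.card_pos.1 hpos
        rw [Finset.mem_filter] at hu
        refine ⟨u, hu.1, ?_, ?_⟩
        · intro h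
          rw [← h, hu.2] at h2
          omega
        · intro i hi
          rw [hu.2] at hi
          have hd : Disjoint (R.filter (fun x => c x = i)) (R.filter (fun x => c x = b)) := by
            rw [Finset.disjoint_left]
            intro x hx hy
            rw [Finset.mem_filter] at hx hy
            exact hi (hx.2.symm.trans hy.2)
          have h3 := Finset.card_union_of_disjoint hd
          have h4 : ((R.filter (fun x => c x = i)) ∪ (R.filter (fun x => c x = b))).card ≤ R.card :=
            Finset.card_le_card (Finset.union_subset (Finset.filter_subset _ _)
              (Finset.filter_subset _ _))
          omega
      · push Not at hb
        have : ∃ u ∈ R, c u ≠ c v := by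
          by_contra hcon
          push Not at hcon
          rw [Finset.filter_true_of_mem hcon] at h2
          omega
        obtain ⟨u, hu, huv⟩ := this
        exact ⟨u, hu, huv, fun i _ => hb i⟩
    obtain ⟨u, hu, huv, hi⟩ := key
    have hc : (R.erase u).card = m := by rw [Finset.card_erase_of_mem hu]; omega
    have hfu : ((R.erase u).filter (fun x => c x = c u)).card + 1
        = (R.filter (fun x => c x = c u)).card := by
      rw [Finset.filter_erase]
      exact Finset.card_erase_add_one (by simp [hu])
    have hle : ∀ i, ((R.erase u).filter (fun x => c x = i)).card
        ≤ (R.filter (fun x => c x = i)).card := fun i =>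
      Finset.card_le_card (Finset.filter_subset_filter _ (Finset.erase_subset _ _))
    obtain ⟨w, q, hq, hs, hl⟩ := ih (R.erase u) u hc (by simp) (by
      intro i
      by_cases h : i = c u
      · subst h
        have := h1 (c u)
        omega
      · have := hi i h
        have := hle i
        omega) (by
      have := h1 (c u)
      omega)
    refine ⟨w, Walk.cons (hG _ _ huv.symm) q, ?_, ?_, ?_⟩
    · rw [Walk.cons_isPath_iff]
      refine ⟨hq, fun hv' => ?_⟩
      rcases hs v hv' with h | h
      · exact hv (h ▸ hu)
      · exact hv (Finset.mem_of_mem_erase h)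
    · intro x hx
      rw [Walk.support_cons, List.mem_cons] at hx
      rcases hx with h | h
      · exact Or.inl h
      · rcases hs x h with h | h
        · exact Or.inr (h ▸ hu)
        · exact Or.inr (Finset.mem_of_mem_erase h)
    · simp [hl]

theorem aux_count {V ι : Type*} [DecidableEq ι] (G : SimpleGraph V) (c : V → ι)
    (hG : ∀ u v, G.Adj u v → c u ≠ c v) (b : ι) {v w : V} (q : G.Walk v w) :
    q.length + 1 ≤ 2 * q.support.countP (fun x => c x ≠ b) + (if c v = b then 1 else 0) := by
  induction q with
  | nil => 
    rw [Walk.support_nil, List.countP_singleton]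
    split_ifs <;> simp_all
  | @cons u v w h q ih =>
    rw [Walk.support_cons, List.countP_cons, Walk.length_cons]
    have := hG _ _ h
    by_cases h1 : c u = b
    · have h2 : c v ≠ b := fun h => this (h1.trans h.symm)
      simp [h1, h2] at ih ⊢
      omega
    · simp [h1] at ih ⊢
      split_ifs at ih <;> omega

theorem aux_upper {V ι : Type*} [Fintype V] [DecidableEq V] [DecidableEq ι] (G : SimpleGraph V)
    (c : V → ι)
    (hG : ∀ u v, G.Adj u v → c u ≠ c v) (b : ι) {v w : V} (q : G.Walk v w) (hq : q.IsPath) :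
    q.length + 1 ≤ 2 * (Finset.univ.filter (fun x => c x ≠ b)).card
      + (if c v = b then 1 else 0) := by
  have h := aux_count G c hG b q
  have h2 : q.support.countP (fun x => c x ≠ b) ≤ (Finset.univ.filter (fun x => c x ≠ b)).card := by
    rw [List.countP_eq_length_filter, ← List.toFinset_card_of_nodup (hq.support_nodup.filter _)]
    apply Finset.card_le_card
    intro x hx
    simpa using (by simpa using hx : x ∈ q.support ∧ _).2
  omega

theorem aux_eq {V : Type*} (G : SimpleGraph V) (v : V) (m : ℕ)
    (h1 : ∃ (w : V) (q : G.Walk v w), q.IsPath ∧ m = q.length + 1)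
    (h2 : ∀ (w : V) (q : G.Walk v w), q.IsPath → q.length + 1 ≤ m) :
    vertexDetourOrder G v = m := by
  apply IsGreatest.csSup_eq
  refine ⟨h1, ?_⟩
  rintro k ⟨w, q, hq, rfl⟩
  exact h2 w q hq

theorem aux_fiber {p : ℕ} (n : Fin p → ℕ) (i : Fin p) :
    (Finset.univ.filter (fun x : Σ i : Fin p, Fin (n i) => x.1 = i)).card = n i := by
  have : (Finset.univ.filter (fun x : Σ i : Fin p, Fin (n i) => x.1 = i))
      = (Finset.univ : Finset (Fin (n i))).map (Function.Embedding.sigmaMk i) := by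
    ext ⟨j, x⟩
    simp only [Finset.mem_filter, Finset.mem_univ, true_and, Finset.mem_map,
      Function.Embedding.sigmaMk_apply]
    constructor
    · rintro rfl
      exact ⟨x, rfl⟩
    · rintro ⟨y, hy⟩
      exact (congrArg Sigma.fst hy).symm
  rw [this]
  simp

theorem stmt_8 (p : ℕ) (hp : 2 ≤ p) (n : Fin p → ℕ) (hmono : Monotone n) :
    (2 * n ⟨p - 1, by omega⟩ ≤ ∑ i, n i →
      ∀ v : Σ i : Fin p, Fin (n i),
        vertexDetourOrder (completeMultipartiteGraph (fun i : Fin p => Fin (n i))) v =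
          ∑ i, n i) ∧
    (∑ i, n i < 2 * n ⟨p - 1, by omega⟩ →
      ∀ v : Σ i : Fin p, Fin (n i),
        (v.1 = ⟨p - 1, by omega⟩ →
          vertexDetourOrder (completeMultipartiteGraph (fun i : Fin p => Fin (n i))) v =
            2 * (∑ i, n i - n ⟨p - 1, by omega⟩) + 1) ∧
        (v.1 ≠ ⟨p - 1, by omega⟩ →
          vertexDetourOrder (completeMultipartiteGraph (fun i : Fin p => Fin (n i))) v =
            2 * (∑ i, n i - n ⟨p - 1, by omega⟩))) := by
  classical
  set L : Fin p := ⟨p - 1, by omega⟩ with hL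
  set G := completeMultipartiteGraph (fun i : Fin p => Fin (n i)) with hGdef
  have hG1 : ∀ u v : Σ i : Fin p, Fin (n i), u.1 ≠ v.1 → G.Adj u v := fun u v h => h
  have hG2 : ∀ u v : Σ i : Fin p, Fin (n i), G.Adj u v → u.1 ≠ v.1 := fun u v h => h
  have hmax : ∀ i, n i ≤ n L := fun i => hmono (by rw [Fin.le_def]; simp only [hL]; omega)
  have hcard : Fintype.card (Σ i : Fin p, Fin (n i)) = ∑ i, n i := by simp
  have hfib := aux_fiber n
  have hcompl : (Finset.univ.filter (fun x : Σ i : Fin p, Fin (n i) => x.1 ≠ L)).card + n L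
      = ∑ i, n i := by
    rw [← hcard, ← hfib L, add_comm]
    exact Finset.card_filter_add_card_filter_not _
  generalize ∑ i, n i = N at *
  constructor
  · intro h v
    apply aux_eq
    · have hR : (Finset.univ.erase v).card = N - 1 := by
        rw [Finset.card_erase_of_mem (Finset.mem_univ v), Finset.card_univ, hcard]
      have hN : 0 < N := by rw [← hcard]; exact Fintype.card_pos_iff.2 ⟨v⟩
      obtain ⟨w, q, hq, -, hl⟩ := aux_path G Sigma.fst hG1 (N - 1) (Finset.univ.erase v) v hR
        (by simp) (by
          intro i
          have h1 := hfib i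
          have h2 := hmax i
          have h3 : ((Finset.univ.erase v).filter (fun x => x.1 = i)).card ≤ n i := by
            rw [← h1]
            exact Finset.card_le_card (Finset.filter_subset_filter _ (Finset.erase_subset _ _))
          omega) (by
          have h1 := hfib v.1
          have h2 := hmax v.1
          have h3 : ((Finset.univ.erase v).filter (fun x => x.1 = v.1)).card + 1 = n v.1 := by
            rw [← h1, Finset.filter_erase]
            exact Finset.card_erase_add_one (by simp)
          omega)
      exact ⟨w, q, hq, by omega⟩
    · intro w q hq
      rw [← hcard]
      exact hq.length_lt
  · intro h v
    set A := Finset.univ.filter (fun x : Σ i : Fin p, Fin (n i) => x.1 ≠ L) with hA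
    set B := Finset.univ.filter (fun x : Σ i : Fin p, Fin (n i) => x.1 = L) with hB
    have hBc : B.card = n L := hfib L
    have key : ∀ A' B' : Finset (Σ i : Fin p, Fin (n i)), A' ⊆ A → B' ⊆ B →
        (A' ∪ B').card = A'.card + B'.card ∧
        ((A' ∪ B').filter (fun x => x.1 = L)).card = B'.card ∧
        ∀ i, i ≠ L → ((A' ∪ B').filter (fun x => x.1 = i)).card ≤ A'.card := by
      intro A' B' hA' hB'
      have hA'' : ∀ x ∈ A', x.1 ≠ L := fun x hx => (Finset.mem_filter.1 (hA' hx)).2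
      have hB'' : ∀ x ∈ B', x.1 = L := fun x hx => (Finset.mem_filter.1 (hB' hx)).2
      refine ⟨?_, ?_, ?_⟩
      · apply Finset.card_union_of_disjoint
        rw [Finset.disjoint_left]
        exact fun x hx hy => hA'' x hx (hB'' x hy)
      · rw [Finset.filter_union, Finset.filter_false_of_mem hA'', Finset.filter_true_of_mem hB'',
          Finset.empty_union]
      · intro i hi
        rw [Finset.filter_union, Finset.filter_false_of_mem (s := B')
          (fun x hx h => hi (h.symm.trans (hB'' x hx))), Finset.union_empty]
        exact Finset.card_le_card (Finset.filter_subset _ _)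
    constructor
    · intro hv
      apply aux_eq
      · have hvB : v ∈ B := by simp [hB, hv]
        have h1 := Finset.card_erase_add_one hvB
        obtain ⟨B', hB', hB'c⟩ := Finset.exists_subset_card_eq (s := B.erase v) (n := A.card)
          (by omega)
        obtain ⟨k1, k2, k3⟩ := key A B' subset_rfl (hB'.trans (Finset.erase_subset _ _))
        obtain ⟨w, q, hq, -, hl⟩ := aux_path G Sigma.fst hG1 _ (A ∪ B') v rfl
          (by
            rw [Finset.mem_union]
            rintro (h | h)
            · exact (Finset.mem_filter.1 h).2 hv
            · exact Finset.notMem_erase _ _ (hB' h))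
          (by
            intro i
            by_cases hi : i = L
            · rw [hi]; omega
            · have := k3 i hi
              omega)
          (by rw [hv]; omega)
        exact ⟨w, q, hq, by omega⟩
      · intro w q hq
        have : q.length + 1 ≤ 2 * A.card + 1 := by
          have := aux_upper G Sigma.fst hG2 L q hq
          rw [if_pos hv] at this
          convert this
        omega
    · intro hv
      apply aux_eq
      · have hvA : v ∈ A := by simp [hA, hv]
        have h1 := Finset.card_erase_add_one hvA
        obtain ⟨B', hB', hB'c⟩ := Finset.exists_subset_card_eq (s := B) (n := A.card)
          (by omega)
        obtain ⟨k1, k2, k3⟩ := key (A.erase v) B' (Finset.erase_subset _ _) hB'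
        obtain ⟨w, q, hq, -, hl⟩ := aux_path G Sigma.fst hG1 _ (A.erase v ∪ B') v rfl
          (by
            rw [Finset.mem_union]
            rintro (h | h)
            · exact Finset.notMem_erase _ _ h
            · exact hv (Finset.mem_filter.1 (hB' h)).2)
          (by
            intro i
            by_cases hi : i = L
            · rw [hi]; omega
            · have := k3 i hi
              omega)
          (by
            have := k3 v.1 hv
            omega)
        exact ⟨w, q, hq, by omega⟩
      · intro w q hq
        have : q.length + 1 ≤ 2 * A.card + 0 := by
          have := aux_upper G Sigma.fst hG2 L q hq
          rw [if_neg hv] at this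
          convert this
        omega
end

section
/- Let G be a CND graph (a finite connected simple graph with no hamiltonian path in which every vertex has detour order equal to τ(G)). Then G is 2-connected: G has at least 3 vertices, and for every vertex v the graph G − v is connected. -/
open SimpleGraph

theorem stmt_10 {V : Type*} [Fintype V] (G : SimpleGraph V) (hconn : G.Connected)
    (hnt : ¬ Traceable G)
    (hdet : ∀ v : V, vertexDetourOrder G v = detourOrder G) :
    3 ≤ Fintype.card V ∧ ∀ v : V, (G.induce ({v}ᶜ : Set V)).Connected := by
  classical
  have hcard : 3 ≤ Fintype.card V := by
    obtain ⟨v⟩ := hconn.nonempty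
    have h1 : ∃ x, x ≠ v := by
      by_contra! hc
      exact hnt ⟨v, v, Walk.nil, by simp, fun x => by simp [hc x]⟩
    obtain ⟨x, hx⟩ := h1
    obtain ⟨r⟩ := hconn.preconnected v x
    cases r with
    | nil => exact absurd rfl hx
    | @cons _ y _ h q =>
      have h2 : ∃ z, z ≠ v ∧ z ≠ y := by
        by_contra! hc
        refine hnt ⟨v, y, Walk.cons h Walk.nil, by simp [h.ne], fun x => ?_⟩
        by_cases hxv : x = v
        · simp [hxv]
        · simp [hc x hxv]
      obtain ⟨z, hz1, hz2⟩ := h2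
      exact Fintype.two_lt_card_iff.2 ⟨v, y, z, h.ne, hz1.symm, hz2.symm⟩
  refine ⟨hcard, fun v => ?_⟩
  have hmem : vertexDetourOrder G v ∈
      {n | ∃ (w : V) (p : G.Walk v w), p.IsPath ∧ n = p.length + 1} := by
    refine Nat.sSup_mem ⟨1, v, Walk.nil, by simp, by simp⟩ ⟨Fintype.card V, ?_⟩
    rintro n ⟨w, p, hp, rfl⟩
    exact hp.length_lt
  obtain ⟨w, p, hp, hn⟩ := hmem
  have hmax : ∀ (a b : V) (q : G.Walk a b), q.IsPath → q.length ≤ p.length := by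
    intro a b q hq
    have : q.length + 1 ≤ detourOrder G := by
      refine le_csSup ⟨Fintype.card V, ?_⟩ ⟨a, b, q, hq, rfl⟩
      rintro n ⟨u, w, p, hp, rfl⟩
      exact hp.length_lt
    have := hdet v
    omega
  have hnb : ∀ x, G.Adj x v → x ∈ p.support := by
    intro x hx
    by_contra hc
    have := hmax _ _ (Walk.cons hx p) (hp.cons hc)
    simp at this
  obtain ⟨y, hy⟩ : ∃ y, y ≠ v := Fintype.exists_ne_of_one_lt_card (by omega) v
  cases p with
  | nil =>
    exfalso
    obtain ⟨r⟩ := hconn.preconnected v y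
    cases r with
    | nil => exact hy rfl
    | cons h q =>
      have := hnb _ h.symm
      simp at this
      exact h.ne this.symm
  | @cons _ u _ h q =>
    rw [Walk.cons_isPath_iff] at hp
    have hu : u ∈ ({v}ᶜ : Set V) := by simpa using h.ne.symm
    have key : ∀ (x z : V) (r : G.Walk x z), z = v → ∀ hx : x ∈ ({v}ᶜ : Set V),
        (G.induce ({v}ᶜ : Set V)).Reachable ⟨u, hu⟩ ⟨x, hx⟩ := by
      intro x z r
      induction r with
      | nil => intro hz hx; exact absurd hz hx
      | @cons a b c hab r ih =>
        intro hz hx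
        by_cases hb : b = v
        · subst hb
          have ha := hnb a hab
          rw [Walk.support_cons, List.mem_cons] at ha
          have ha := ha.resolve_left hx
          refine ⟨(q.takeUntil a ha).induce _ ?_⟩
          intro t ht
          have := q.support_takeUntil_subset_support ha ht
          rintro rfl
          exact hp.2 this
        · refine (ih hz hb).trans (Adj.reachable ?_)
          simpa using hab.symm
    have : Nonempty ({v}ᶜ : Set V) := ⟨⟨u, hu⟩⟩
    refine ⟨?_⟩
    rintro ⟨a, ha⟩ ⟨b, hb⟩
    obtain ⟨r⟩ := hconn.preconnected a v
    obtain ⟨s⟩ := hconn.preconnected b v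
    exact (key a v r rfl ha).symm.trans (key b v s rfl hb)
end

section
/- Let G be a CND graph (a finite connected simple graph with no hamiltonian path in which every vertex has detour order equal to τ(G)). Then every vertex of G has at most one neighbour of degree 2. -/
open SimpleGraph

theorem aux_close {V : Type*} (G : SimpleGraph V) (hconn : G.Connected) (hnt : ¬ Traceable G)
    {v x : V} (p : G.Walk v x) (hp : p.IsPath) (hadj : G.Adj v x) (hne : x ≠ p.snd)
    (hmax : ∀ (a b : V) (q : G.Walk a b), q.IsPath → q.length ≤ p.length) : False := by
  classical
  apply hnt
  refine ⟨v, x, p, hp, ?_⟩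
  by_contra hcon
  push Not at hcon
  obtain ⟨y, hy⟩ := hcon
  obtain ⟨r⟩ := hconn.preconnected v y
  obtain ⟨d, -, hd1, hd2⟩ := r.exists_boundary_dart {z | z ∈ p.support} (by simp) (by simpa using hy)
  simp only [Set.mem_ofPred_eq] at hd1 hd2
  have hc : (Walk.cons hadj.symm p).IsCycle := by
    rw [Walk.cons_isCycle_iff]
    refine ⟨hp, fun h => hne ?_⟩
    rw [Sym2.eq_swap] at h
    exact hp.eq_snd_of_mem_edges h
  have hm : d.fst ∈ (Walk.cons hadj.symm p).support := by simp [hd1]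
  set c := (Walk.cons hadj.symm p).rotate d.fst hm with hcdef
  have hc' : c.IsCycle := (Walk.isCycle_rotate hm).2 hc
  have hsub : ∀ z ∈ c.support, z ∈ p.support := by
    intro z hz
    rw [hcdef, Walk.mem_support_rotate_iff] at hz
    simp only [Walk.support_cons, List.mem_cons] at hz
    rcases hz with rfl | hz
    · simp
    · exact hz
  have hlen : c.length = p.length + 1 := by simp [hcdef]
  have hq : (Walk.cons d.adj.symm c.tail.reverse).IsPath := by
    rw [Walk.cons_isPath_iff]
    refine ⟨hc'.isPath_tail.reverse, fun h => hd2 (hsub _ ?_)⟩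
    rw [Walk.support_reverse, List.mem_reverse] at h
    rw [← Walk.cons_support_tail hc'.not_nil]
    exact List.mem_cons_of_mem _ h
  have := hmax _ _ _ hq
  simp only [Walk.length_cons, Walk.length_reverse, Walk.length_tail] at this
  omega

theorem aux_pos {V : Type*} [Fintype V] (G : SimpleGraph V) [DecidableRel G.Adj]
    {v x u : V} (p : G.Walk v x) (hp : p.IsPath) (hadj : G.Adj v u) (hdeg : G.degree u = 2)
    (hmax : ∀ (a b : V) (q : G.Walk a b), q.IsPath → q.length ≤ p.length) :
    u = p.snd ∨ u = x := by
  classical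
  have hu : u ∈ p.support := by
    by_contra h
    have := hmax _ _ (Walk.cons hadj.symm p) ((Walk.cons_isPath_iff _ _).2 ⟨hp, h⟩)
    simp at this
  obtain ⟨i, hi, hil⟩ := Walk.mem_support_iff_exists_getVert.1 hu
  rcases Nat.lt_or_ge i 2 with h2 | h2
  · interval_cases i
    · simp at hi
      exact absurd hi hadj.ne
    · exact Or.inl hi.symm
  rcases eq_or_lt_of_le hil with h3 | h3
  · right
    rw [← hi, h3, Walk.getVert_length]
  exfalso
  have inj := hp.getVert_injOn
  have e1 : G.Adj u (p.getVert (i+1)) := by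
    rw [← hi]; exact p.adj_getVert_succ h3
  have e2 : G.Adj u (p.getVert (i-1)) := by
    have := p.adj_getVert_succ (i := i-1) (by omega)
    rw [show i - 1 + 1 = i by omega, hi] at this
    exact this.symm
  have n1 : p.getVert (i+1) ≠ p.getVert (i-1) := fun h => by
    have := inj (by simp; omega) (by simp; omega) h
    omega
  have n2 : p.getVert 0 ≠ p.getVert (i-1) := fun h => by
    have := inj (by simp) (by simp; omega) h
    omega
  have n3 : p.getVert 0 ≠ p.getVert (i+1) := fun h => by
    have := inj (by simp) (by simp; omega) h
    omega
  rw [Walk.getVert_zero] at n2 n3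
  have hs : ({v, p.getVert (i+1), p.getVert (i-1)} : Finset V) ⊆ G.neighborFinset u := by
    intro z hz
    simp only [Finset.mem_insert, Finset.mem_singleton] at hz
    rw [mem_neighborFinset]
    rcases hz with rfl | rfl | rfl
    · exact hadj.symm
    · exact e1
    · exact e2
  have := Finset.card_le_card hs
  rw [card_neighborFinset_eq_degree, hdeg, Finset.card_eq_three.2 ⟨_, _, _, n3, n2, n1, rfl⟩] at this
  omega

theorem stmt_11 {V : Type*} [Fintype V] (G : SimpleGraph V) [DecidableRel G.Adj]
    (hconn : G.Connected) (hnt : ¬ Traceable G)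
    (hdet : ∀ v : V, vertexDetourOrder G v = detourOrder G) :
    ∀ v u w : V, G.Adj v u → G.Adj v w →
      G.degree u = 2 → G.degree w = 2 → u = w := by
  intro v u w hvu hvw hu hw
  have hb1 : BddAbove {n | ∃ (u w : V) (p : G.Walk u w), p.IsPath ∧ n = p.length + 1} :=
    ⟨Fintype.card V, by rintro n ⟨a, b, p, hp, rfl⟩; exact hp.length_lt⟩
  have hb2 : BddAbove {n | ∃ (w : V) (p : G.Walk v w), p.IsPath ∧ n = p.length + 1} :=
    ⟨Fintype.card V, by rintro n ⟨b, p, hp, rfl⟩; exact hp.length_lt⟩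
  have hn2 : {n | ∃ (w : V) (p : G.Walk v w), p.IsPath ∧ n = p.length + 1}.Nonempty :=
    ⟨1, v, Walk.nil, Walk.IsPath.nil, rfl⟩
  obtain ⟨x, p, hp, hpl⟩ := Nat.sSup_mem hn2 hb2
  have hmax : ∀ (a b : V) (q : G.Walk a b), q.IsPath → q.length ≤ p.length := by
    intro a b q hq
    have h1 : q.length + 1 ≤ detourOrder G := le_csSup hb1 ⟨a, b, q, hq, rfl⟩
    rw [← hdet v] at h1
    unfold vertexDetourOrder at h1
    omega
  by_contra hne
  rcases aux_pos G p hp hvu hu hmax with h1 | h1 <;>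
    rcases aux_pos G p hp hvw hw hmax with h2 | h2
  · exact hne (h1.trans h2.symm)
  · subst h2
    exact aux_close G hconn hnt p hp hvw (fun h => hne (h1.trans h.symm)) hmax
  · subst h1
    exact aux_close G hconn hnt p hp hvu (fun h => hne (h.trans h2.symm)) hmax
  · exact hne (h1.trans h2.symm)
end

section
/- Let G be a CND graph (a finite connected simple graph with no hamiltonian path in which every vertex has detour order equal to τ(G)). Then the maximum degree of G satisfies Δ(G) ≤ τ(G) − 4. -/
open SimpleGraph

namespace CND

def IsP {V : Type*} (G : SimpleGraph V) (f : ℕ → V) (k : ℕ) : Prop :=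
  (∀ i, i + 1 < k → G.Adj (f i) (f (i+1))) ∧ (∀ i j, i < k → j < k → f i = f j → i = j)

lemma IsP.walk {V : Type*} {G : SimpleGraph V} (k : ℕ) : ∀ (f : ℕ → V), IsP G f (k+1) →
    ∃ p : G.Walk (f 0) (f k), p.IsPath ∧ p.length = k ∧ ∀ x ∈ p.support, ∃ i, i < k+1 ∧ f i = x := by
  induction k with
  | zero =>
    intro f hf
    exact ⟨Walk.nil, by simp, by simp, by simp⟩
  | succ k ih =>
    intro f hf
    obtain ⟨p, hp, hl, hs⟩ := ih (fun i => f (i+1))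
      ⟨fun i hi => hf.1 (i+1) (by omega), fun i j hi hj h => by
        have := hf.2 (i+1) (j+1) (by omega) (by omega) h
        omega⟩
    refine ⟨Walk.cons (hf.1 0 (by omega)) p, ?_, by simp [hl], ?_⟩
    · rw [Walk.cons_isPath_iff]
      refine ⟨hp, fun h => ?_⟩
      obtain ⟨i, hi, h⟩ := hs _ h
      have := hf.2 (i+1) 0 (by omega) (by omega) h
      omega
    · intro x hx
      simp only [Walk.support_cons, List.mem_cons] at hx
      rcases hx with rfl | hx
      · exact ⟨0, by omega, rfl⟩
      · obtain ⟨i, hi, h⟩ := hs _ hx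
        exact ⟨i+1, by omega, h⟩

lemma isP_getVert {V : Type*} {G : SimpleGraph V} {u w : V} (p : G.Walk u w) (hp : p.IsPath) :
    IsP G p.getVert (p.length + 1) := by
  refine ⟨fun i hi => p.adj_getVert_succ (by omega), fun i j hi hj h => ?_⟩
  exact hp.getVert_injOn (by simp; omega) (by simp; omega) h

section
variable {V : Type*} {G : SimpleGraph V} {t : ℕ}

lemma L1 (h1 : ∀ f k, IsP G f k → k ≤ t) {f : ℕ → V} (hf : IsP G f t) {w : V}
    (ha : G.Adj (f 0) w) : ∃ i, i < t ∧ f i = w := by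
  by_contra hc
  push Not at hc
  have := h1 (fun n => if n = 0 then w else f (n-1)) (t+1) ⟨?_, ?_⟩
  · omega
  · intro i hi
    rcases i with _ | i
    · simpa using ha.symm
    · simpa using hf.1 i (by omega)
  · intro i j hi hj h
    rcases i with _ | i <;> rcases j with _ | j
    · rfl
    · simp at h; exact absurd h.symm (hc j (by omega))
    · simp at h; exact absurd h (hc i (by omega))
    · simp at h; have := hf.2 i j (by omega) (by omega) h; omega

/-- append at the end -/
lemma L1' (h1 : ∀ f k, IsP G f k → k ≤ t) {f : ℕ → V} (hf : IsP G f t) {w : V} (ht : 0 < t)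
    (ha : G.Adj (f (t-1)) w) : ∃ i, i < t ∧ f i = w := by
  obtain ⟨i, hi, h⟩ := L1 h1 (f := fun n => f (t-1-n)) (w := w) ⟨fun i hi => by
      have := hf.1 (t-1-(i+1)) (by omega)
      rw [show t-1-(i+1)+1 = t-1-i by omega] at this
      exact this.symm, fun i j hi hj h => by
      have := hf.2 _ _ (by omega) (by omega) h
      omega⟩ (by simpa using ha)
  exact ⟨t-1-i, by omega, h⟩

lemma L2 (h1 : ∀ f k, IsP G f k → k ≤ t) (h2 : ∀ v, ∃ f, f 0 = v ∧ IsP G f t)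
    (S : Set V) (b u w : V) (hS : ∀ s ∈ S, ∀ w, w ∉ S → G.Adj s w → w = b)
    (hb : b ∉ S)
    (hu : u ∈ S) (hw : w ∉ S) (hbu : G.Adj b u) (hbw : G.Adj b w) : False := by
  obtain ⟨f, rfl, hf⟩ := h2 b
  obtain ⟨i, hi, rfl⟩ := L1 h1 hf hbu
  obtain ⟨k, hk, rfl⟩ := L1 h1 hf hbw
  have key : ∀ m, m + 1 < t → (f (m+1) ∈ S ↔ f 1 ∈ S) := by
    intro m
    induction m with
    | zero => simp
    | succ m ih =>
      intro hm
      rw [← ih (by omega)]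
      have ha := hf.1 (m+1) (by omega)
      constructor
      · intro h
        by_contra h'
        have := hf.2 _ _ (by omega) (by omega) (hS _ h _ h' ha.symm)
        omega
      · intro h
        by_contra h'
        have := hf.2 _ _ (by omega) (by omega) (hS _ h _ h' ha)
        omega
  have hi0 : i ≠ 0 := by rintro rfl; exact G.loopless.irrefl _ hbu
  have hk0 : k ≠ 0 := by rintro rfl; exact G.loopless.irrefl _ hbw
  have e1 := key (i-1) (by omega)
  have e2 := key (k-1) (by omega)
  rw [show i-1+1 = i by omega] at e1
  rw [show k-1+1 = k by omega] at e2
  exact hw (e2.2 (e1.1 hu))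

/-- rotate -/
lemma rot {f : ℕ → V} (hf : IsP G f t) (m : ℕ) (hm : m + 1 < t) (ha : G.Adj (f 0) (f (m+1))) :
    IsP G (fun n => if n ≤ m then f (m-n) else f n) t := by
  constructor
  · intro i hi
    rcases lt_trichotomy i m with h | h | h
    · have := hf.1 (m-(i+1)) (by omega)
      rw [show m-(i+1)+1 = m-i by omega] at this
      simpa [h.le, show i+1 ≤ m by omega] using this.symm
    · subst h; simpa using ha
    · simpa [show ¬ i ≤ m by omega, show ¬ i+1 ≤ m by omega] using hf.1 i hi
  · intro i j hi hj h
    try dsimp only at h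
    split_ifs at h <;> have := hf.2 _ _ (by omega) (by omega) h <;> omega

/-- rotate a cycle -/
lemma rotc {f : ℕ → V} (hf : IsP G f t) (m : ℕ) (hm : m < t) (ha : G.Adj (f 0) (f (t-1))) :
    IsP G (fun n => if n ≤ m then f (m-n) else f (t+m-n)) t := by
  constructor
  · intro i hi
    rcases lt_trichotomy i m with h | h | h
    · have := hf.1 (m-(i+1)) (by omega)
      rw [show m-(i+1)+1 = m-i by omega] at this
      simpa [h.le, show i+1 ≤ m by omega] using this.symm
    · subst h; simpa [show t + i - (i+1) = t-1 by omega] using ha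
    · have := hf.1 (t+m-(i+1)) (by omega)
      rw [show t+m-(i+1)+1 = t+m-i by omega] at this
      simpa [show ¬ i ≤ m by omega, show ¬ i+1 ≤ m by omega] using this.symm
  · intro i j hi hj h
    try dsimp only at h
    split_ifs at h <;> have := hf.2 _ _ (by omega) (by omega) h <;> omega

lemma L4 (h1 : ∀ f k, IsP G f k → k ≤ t) {f : ℕ → V} (hf : IsP G f t) (j : ℕ)
    (hx : ∀ i, 1 ≤ i → i + 1 < t → i ≠ j → G.Adj (f 0) (f i))
    (y : V) (hy : ∀ i, i < t → f i ≠ y) (m : ℕ) (hm : m < t) (ha : G.Adj (f m) y) :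
    m + 2 = t ∨ (m + 1 = j ∧ j + 2 ≤ t) := by
  by_contra hc
  by_cases e : m + 1 = t
  · obtain ⟨i, hi, h⟩ := L1' h1 hf (w := y) (by omega) (by rwa [show t - 1 = m by omega])
    exact hy i hi h
  · obtain ⟨i, hi, h⟩ := L1 h1 (rot hf m (by omega) (hx _ (by omega) (by omega) (by omega)))
      (w := y) (by simpa using ha)
    try dsimp only at h
    split_ifs at h
    · exact hy _ (by omega) h
    · exact hy _ (by omega) h

lemma L5 (h1 : ∀ f k, IsP G f k → k ≤ t) (h2 : ∀ v, ∃ f, f 0 = v ∧ IsP G f t)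
    {f : ℕ → V} (hf : IsP G f t) (j : ℕ)
    (hx : ∀ i, 1 ≤ i → i + 1 < t → i ≠ j → G.Adj (f 0) (f i)) (ht : 3 ≤ t)
    (y : V) (hy : ∀ i, i < t → f i ≠ y) (ha : G.Adj (f (t-2)) y) :
    j + 2 ≤ t ∧ G.Adj y (f (j-1)) ∧ ∀ w, G.Adj y w → w = f (t-2) ∨ w = f (j-1) := by
  have hN : ∀ w, G.Adj y w → w = f (t-2) ∨ (w = f (j-1) ∧ j + 2 ≤ t) := by
    intro w hw
    by_cases hwP : ∃ m, m < t ∧ f m = w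
    · obtain ⟨m, hm, rfl⟩ := hwP
      rcases L4 h1 hf j hx y hy m hm hw.symm with h | ⟨h, h'⟩
      · left; congr 1; omega
      · right; exact ⟨by congr 1; omega, h'⟩
    · push Not at hwP
      exfalso
      have hP : IsP G (fun n => if n = t - 1 then y else f n) t := by
        constructor
        · intro i hi
          by_cases e : i = t - 2
          · subst e
            simpa [show t - 2 + 1 = t - 1 by omega, show t-2 ≠ t-1 by omega] using ha
          · simpa [show i ≠ t - 1 by omega, show i + 1 ≠ t - 1 by omega] using hf.1 i hi
        · intro i k hi hk h
          try dsimp only at h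
          split_ifs at h
          · omega
          · exact absurd h.symm (hy _ hk)
          · exact absurd h (hy _ hi)
          · exact hf.2 _ _ hi hk h
      obtain ⟨i, hi, h⟩ := L1' h1 hP (w := w) (by omega) (by simpa using hw)
      try dsimp only at h
      split_ifs at h
      · exact G.loopless.irrefl _ (h ▸ hw)
      · exact hwP i hi h
  have key : j + 2 ≤ t ∧ G.Adj y (f (j-1)) := by
    by_contra hc
    refine L2 h1 h2 {y} (f (t-2)) y (f (t-3)) ?_ ?_ rfl ?_ ha ?_
    · rintro s rfl w - hw
      rcases hN w hw with h | ⟨h, h'⟩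
      · exact h
      · exact absurd ⟨h', h ▸ hw⟩ hc
    · exact hy _ (by omega)
    · exact hy _ (by omega)
    · have := hf.1 (t-3) (by omega)
      rw [show t-3+1 = t-2 by omega] at this
      exact this.symm
  refine ⟨key.1, key.2, fun w hw => ?_⟩
  rcases hN w hw with h | h
  · exact Or.inl h
  · exact Or.inr h.1

lemma L6a {f : ℕ → V} (hf : IsP G f t) (b : V) (i k l : ℕ) (h0 : 0 < i) (hik : i < k) (hkl : k < l)
    (hl : l < t) (hN : ∀ w, G.Adj (f k) w → w = f 0 ∨ w = b) : False := by
  have a1 := hf.1 k (by omega)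
  have a2 := hf.1 (k-1) (by omega)
  rw [show k-1+1 = k by omega] at a2
  rcases hN _ a1 with h | h
  · have := hf.2 _ _ (by omega) (by omega) h; omega
  · rcases hN _ a2.symm with h' | h'
    · have := hf.2 _ _ (by omega) (by omega) h'; omega
    · have := hf.2 _ _ (by omega) (by omega) (h.trans h'.symm); omega

lemma L6 (h1 : ∀ f k, IsP G f k → k ≤ t) (h2 : ∀ v, ∃ f, f 0 = v ∧ IsP G f t)
    (a b u v w : V) (huv : u ≠ v) (huw : u ≠ w) (hvw : v ≠ w)
    (hu : G.Adj a u) (hv : G.Adj a v) (hw : G.Adj a w)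
    (Nu : ∀ z, G.Adj u z → z = a ∨ z = b) (Nv : ∀ z, G.Adj v z → z = a ∨ z = b)
    (Nw : ∀ z, G.Adj w z → z = a ∨ z = b) : False := by
  obtain ⟨f, rfl, hf⟩ := h2 a
  obtain ⟨i, hi, rfl⟩ := L1 h1 hf hu
  obtain ⟨k, hk, rfl⟩ := L1 h1 hf hv
  obtain ⟨l, hl, rfl⟩ := L1 h1 hf hw
  have hi0 : i ≠ 0 := by rintro rfl; exact G.loopless.irrefl _ hu
  have hk0 : k ≠ 0 := by rintro rfl; exact G.loopless.irrefl _ hv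
  have hl0 : l ≠ 0 := by rintro rfl; exact G.loopless.irrefl _ hw
  have e1 : i ≠ k := fun h => huv (by rw [h])
  have e2 : i ≠ l := fun h => huw (by rw [h])
  have e3 : k ≠ l := fun h => hvw (by rw [h])
  rcases lt_or_gt_of_ne e1 with c1 | c1 <;> rcases lt_or_gt_of_ne e2 with c2 | c2 <;>
    rcases lt_or_gt_of_ne e3 with c3 | c3
  · exact L6a hf b i k l (by omega) c1 c3 hl Nv
  · exact L6a hf b i l k (by omega) c2 c3 hk Nw
  · omega
  · exact L6a hf b l i k (by omega) c2 c1 hk Nu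
  · exact L6a hf b k i l (by omega) c1 c2 hl Nu
  · omega
  · exact L6a hf b k l i (by omega) c3 c2 hi Nw
  · exact L6a hf b l k i (by omega) c3 c1 hi Nv

lemma crossing (hconn : G.Connected) (h3 : ∀ f, IsP G f t → ∃ x, ∀ i, i < t → f i ≠ x) (ht : 0 < t)
    {f : ℕ → V} (hf : IsP G f t) : ∃ m y, m < t ∧ (∀ i, i < t → f i ≠ y) ∧ G.Adj (f m) y := by
  obtain ⟨x, hx⟩ := h3 f hf
  obtain ⟨p⟩ := hconn.preconnected (f 0) x
  obtain ⟨d, -, hd1, hd2⟩ := p.exists_boundary_dart {z | ∃ i, i < t ∧ f i = z} ⟨0, ht, rfl⟩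
    (by rintro ⟨i, hi, h⟩; exact hx i hi h)
  obtain ⟨m, hm, h⟩ := hd1
  refine ⟨m, d.snd, hm, fun i hi h' => hd2 ⟨i, hi, h'⟩, ?_⟩
  rw [h]; exact d.adj

lemma replace {f : ℕ → V} (hf : IsP G f t) (y : V) (hy : ∀ i, i < t → f i ≠ y) (m : ℕ)
    (ha : 0 < m → m < t → G.Adj (f (m-1)) y) (hb : m + 1 < t → G.Adj y (f (m+1))) :
    IsP G (fun n => if n = m then y else f n) t := by
  constructor
  · intro i hi
    by_cases e : i = m
    · subst e; simpa using hb hi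
    · by_cases e' : i + 1 = m
      · subst e'; simpa using ha (by omega) (by omega)
      · simpa [e, e'] using hf.1 i hi
  · intro i k hi hk h
    try dsimp only at h
    split_ifs at h
    · omega
    · exact absurd h.symm (hy _ hk)
    · exact absurd h (hy _ hi)
    · exact hf.2 _ _ hi hk h

lemma core (hconn : G.Connected) (h1 : ∀ f k, IsP G f k → k ≤ t)
    (h2 : ∀ v, ∃ f, f 0 = v ∧ IsP G f t)
    (h3 : ∀ f, IsP G f t → ∃ x, ∀ i, i < t → f i ≠ x) (ht : 0 < t)
    {f : ℕ → V} (hf : IsP G f t) (j : ℕ) (hj : 2 ≤ j)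
    (hx : ∀ i, 1 ≤ i → i + 1 < t → i ≠ j → G.Adj (f 0) (f i)) : False := by
  have hex : ∃ y, (∀ i, i < t → f i ≠ y) ∧ 2 ≤ t ∧ G.Adj (f (t-2)) y := by
    obtain ⟨m, y, hm, hy, ha⟩ := crossing hconn h3 ht hf
    by_contra hc
    push Not at hc
    have hall : ∀ m y, m < t → (∀ i, i < t → f i ≠ y) → G.Adj (f m) y → m = j-1 ∧ j + 2 ≤ t := by
      intro m y hm hy ha
      rcases L4 h1 hf j hx y hy m hm ha with h | h
      · exact absurd (by rwa [show t-2 = m by omega]) (hc y hy (by omega))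
      · omega
    obtain ⟨rfl, hjt⟩ := hall m y hm hy ha
    refine L2 h1 h2 {z | ∀ i, i < t → f i ≠ z} (f (j-1)) y (f j) ?_ ?_ hy ?_ ha ?_
    · intro s hs w hw hsw
      simp only [Set.mem_ofPred_eq, not_forall, not_not] at hw
      obtain ⟨i, hi, rfl⟩ := hw
      rw [(hall i s hi hs hsw.symm).1]
    · exact fun h => h _ hm rfl
    · exact fun h => h j (by omega) rfl
    · have := hf.1 (j-1) (by omega)
      rwa [show j-1+1 = j by omega] at this
  obtain ⟨y, hy, ht2, hay⟩ := hex
  have ht3 : 3 ≤ t := by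
    by_contra h
    obtain ⟨i, hi, h'⟩ := L1 h1 hf (w := y) (by rwa [show t-2 = 0 by omega] at hay)
    exact hy i hi h'
  obtain ⟨hjt, hyb, hyN⟩ := L5 h1 h2 hf j hx ht3 y hy hay
  have hlast : G.Adj (f (t-2)) (f (t-1)) := by
    have := hf.1 (t-2) (by omega)
    rwa [show t-2+1 = t-1 by omega] at this
  -- the last vertex
  have hP' := replace hf y hy (t-1) (fun _ _ => by rwa [show t-1-1 = t-2 by omega])
    (fun h => by omega)
  obtain ⟨-, hzb, hzN⟩ := L5 h1 h2 hP' j (fun i hi hi' hij => by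
      simpa [show 0 ≠ t-1 by omega, show i ≠ t-1 by omega] using hx i hi hi' hij) ht3 (f (t-1))
    (fun i hi h => by
      try dsimp only at h
      split_ifs at h
      · exact hy _ (by omega) h.symm
      · have := hf.2 _ _ (by omega) (by omega) h; omega)
    (by simpa [show t-2 ≠ t-1 by omega] using hlast)
  simp only [show t-2 ≠ t-1 by omega, show j-1 ≠ t-1 by omega, if_false] at hzb hzN
  rcases lt_trichotomy (j+3) t with hlt | heq | hgt
  · -- long case
    have := h1 (fun n => if n = 0 then y else if n = 1 then f (t-2) else if n = 2 then f (t-1)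
      else if n = 3 then f (j-1) else if n + j < t + 2 then f (n+j-4) else f (n+j-4-(t-2))) (t+1)
      ⟨?_, ?_⟩
    · omega
    · intro i hi
      rcases i with _ | _ | _ | _ | i
      · simpa using hay.symm
      · simpa using hlast
      · simpa using hzb
      · have := hf.1 (j-1) (by omega)
        rw [show j-1+1 = j by omega] at this
        simpa [show 4 + j < t + 2 by omega] using this
      · have E1 : i + 1 + 1 + 1 + 1 + 1 + j - 4 = i + j + 1 := by omega
        have E2 : i + 1 + 1 + 1 + 1 + j - 4 = i + j := by omega
        simp only [E1, E2]
        rcases lt_trichotomy (i + j + 3) t with h | h | h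
        · have := hf.1 (i+j) (by omega)
          simpa [show i + 1 + 1 + 1 + 1 + j < t + 2 by omega,
            show i + 1 + 1 + 1 + 1 + 1 + j < t + 2 by omega] using this
        · have := hx (i+j) (by omega) (by omega) (by omega)
          simpa [show i + 1 + 1 + 1 + 1 + j < t + 2 by omega,
            show ¬ i + 1 + 1 + 1 + 1 + 1 + j < t + 2 by omega,
            show i + j + 1 - (t-2) = 0 by omega] using this.symm
        · have := hf.1 (i+j-(t-2)) (by omega)
          simpa [show ¬ i + 1 + 1 + 1 + 1 + j < t + 2 by omega,
            show ¬ i + 1 + 1 + 1 + 1 + 1 + j < t + 2 by omega,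
            show i + j + 1 - (t-2) = i+j-(t-2)+1 by omega] using this
    · intro i k hi hk h
      try dsimp only at h
      split_ifs at h <;> first
        | omega
        | (exact absurd h (hy _ (by omega)))
        | (exact absurd h.symm (hy _ (by omega)))
        | (have := hf.2 _ _ (by omega) (by omega) h; omega)
  · -- j = t - 3
    have hc : G.Adj (f (t-3)) (f (t-2)) := by
      have := hf.1 (t-3) (by omega)
      rwa [show t-3+1 = t-2 by omega] at this
    have hP'' := replace hf y hy (t-3)
      (fun _ _ => by rw [show t-3-1 = j-1 by omega]; exact hyb.symm)
      (fun h => by rw [show t-3+1 = t-2 by omega]; exact hay.symm)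
    obtain ⟨-, -, hwN⟩ := L5 h1 h2 hP'' j (fun i hi hi' hij => by
        simpa [show 0 ≠ t-3 by omega, show i ≠ t-3 by omega] using hx i hi hi' hij) ht3 (f (t-3))
      (fun i hi h => by
        try dsimp only at h
        split_ifs at h
        · exact hy _ (by omega) h.symm
        · have := hf.2 _ _ (by omega) (by omega) h; omega)
      (by simpa [show t-2 ≠ t-3 by omega] using hc.symm)
    simp only [show t-2 ≠ t-3 by omega, show j-1 ≠ t-3 by omega, if_false] at hwN
    exact L6 h1 h2 (f (t-2)) (f (j-1)) y (f (t-1)) (f (t-3))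
      (fun h => hy _ (by omega) h.symm) (fun h => hy _ (by omega) h.symm)
      (fun h => by have := hf.2 _ _ (by omega) (by omega) h; omega) hay hlast hc.symm hyN hzN hwN
  · -- j = t - 2
    have := h1 (fun n => if n = 0 then y else if n = 1 then f (t-2) else if n = 2 then f (t-1)
      else f (t - n)) (t+1) ⟨?_, ?_⟩
    · omega
    · intro i hi
      rcases i with _ | _ | _ | i
      · simpa using hay.symm
      · simpa using hlast
      · simpa [show j - 1 = t - 3 by omega] using hzb
      · have := hf.1 (t - (i+1+1+1+1)) (by omega)
        rw [show t - (i+1+1+1+1) + 1 = t - (i+1+1+1) by omega] at this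
        simpa using this.symm
    · intro i k hi hk h
      try dsimp only at h
      split_ifs at h <;> first
        | omega
        | (exact absurd h (hy _ (by omega)))
        | (exact absurd h.symm (hy _ (by omega)))
        | (have := hf.2 _ _ (by omega) (by omega) h; omega)

lemma exj [Fintype V] [DecidableRel G.Adj] (hconn : G.Connected) (h1 : ∀ f k, IsP G f k → k ≤ t)
    (h3 : ∀ f, IsP G f t → ∃ x, ∀ i, i < t → f i ≠ x) (ht : 0 < t)
    {f : ℕ → V} (hf : IsP G f t) (hd : t ≤ G.degree (f 0) + 3) :
    ∃ j, 2 ≤ j ∧ ∀ i, 1 ≤ i → i + 1 < t → i ≠ j → G.Adj (f 0) (f i) := by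
  classical
  have hnl : ¬ G.Adj (f 0) (f (t-1)) := by
    intro h
    obtain ⟨m, y, hm, hy, ha⟩ := crossing hconn h3 ht hf
    obtain ⟨i, hi, h⟩ := L1 h1 (rotc hf m hm h) (w := y) (by simpa using ha)
    try dsimp only at h
    split_ifs at h
    · exact hy _ (by omega) h
    · exact hy _ (by omega) h
  have hsub : G.neighborFinset (f 0) ⊆
      ((Finset.Ico 1 (t-1)).filter (fun i => G.Adj (f 0) (f i))).image f := by
    intro w hw
    rw [mem_neighborFinset] at hw
    obtain ⟨i, hi, rfl⟩ := L1 h1 hf hw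
    refine Finset.mem_image_of_mem _ ?_
    rw [Finset.mem_filter, Finset.mem_Ico]
    refine ⟨⟨?_, ?_⟩, hw⟩
    · rcases i with _ | i
      · exact absurd hw (G.loopless.irrefl _)
      · omega
    · by_contra h
      exact hnl (by rwa [show t - 1 = i by omega])
  have hc := (Finset.card_le_card hsub).trans Finset.card_image_le
  rw [card_neighborFinset_eq_degree] at hc
  have hsum := Finset.card_filter_add_card_filter_not (s := Finset.Ico 1 (t-1))
    (fun i => G.Adj (f 0) (f i))
  rw [Nat.card_Ico] at hsum
  have hM : ((Finset.Ico 1 (t-1)).filter (fun i => ¬ G.Adj (f 0) (f i))).card ≤ 1 := by omega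
  rw [Finset.card_le_one] at hM
  by_cases hex : ∃ j, 1 ≤ j ∧ j + 1 < t ∧ ¬ G.Adj (f 0) (f j)
  · obtain ⟨j, hj1, hj2, hj⟩ := hex
    refine ⟨j, ?_, fun i hi hi' hij => ?_⟩
    · by_contra h
      obtain rfl : j = 1 := by omega
      exact hj (hf.1 0 (by omega))
    · by_contra h
      exact hij (hM i (by simp [h]; omega) j (by simp [hj]; omega))
  · push Not at hex
    exact ⟨2, le_rfl, fun i hi hi' _ => hex i hi hi'⟩

end
end CND

theorem stmt_12 {V : Type*} [Fintype V] (G : SimpleGraph V) [DecidableRel G.Adj]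
    (hconn : G.Connected) (hnt : ¬ Traceable G)
    (hdet : ∀ v : V, vertexDetourOrder G v = detourOrder G) :
    G.maxDegree ≤ detourOrder G - 4 := by
  classical
  have : Nonempty V := hconn.nonempty
  have bdd : BddAbove {n | ∃ (u w : V) (p : G.Walk u w), p.IsPath ∧ n = p.length + 1} := by
    refine ⟨Fintype.card V, ?_⟩
    rintro n ⟨u, w, p, hp, rfl⟩
    exact hp.length_lt
  have h1 : ∀ f k, CND.IsP G f k → k ≤ detourOrder G := by
    intro f k hf
    rcases k with _ | k
    · omega
    · obtain ⟨p, hp, hl, -⟩ := CND.IsP.walk k f hf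
      exact le_csSup bdd ⟨_, _, p, hp, by rw [hl]⟩
  have h2 : ∀ v, ∃ f, f 0 = v ∧ CND.IsP G f (detourOrder G) := by
    intro v
    have hmem : vertexDetourOrder G v ∈
        {n | ∃ (w : V) (p : G.Walk v w), p.IsPath ∧ n = p.length + 1} := by
      refine Nat.sSup_mem ⟨1, v, Walk.nil, by simp, by simp⟩ (bdd.mono ?_)
      rintro n ⟨w, p, h⟩
      exact ⟨v, w, p, h⟩
    obtain ⟨w, p, hp, h⟩ := hmem
    rw [hdet] at h
    exact ⟨p.getVert, by simp, h ▸ CND.isP_getVert p hp⟩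
  obtain ⟨v, hv⟩ := G.exists_maximal_degree_vertex
  have ht : 0 < detourOrder G :=
    h1 (fun _ => v) 1 ⟨fun i hi => by omega, fun i j hi hj _ => by omega⟩
  have h3 : ∀ f, CND.IsP G f (detourOrder G) → ∃ x, ∀ i, i < detourOrder G → f i ≠ x := by
    intro f hf
    by_contra hc
    push Not at hc
    obtain ⟨k, hk⟩ : ∃ k, detourOrder G = k + 1 := ⟨detourOrder G - 1, by omega⟩
    rw [hk] at hf hc
    obtain ⟨p, hp, hl, -⟩ := CND.IsP.walk k f hf
    refine hnt ⟨_, _, p, hp, ?_⟩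
    have : p.support.toFinset = Finset.univ := by
      refine (Finset.card_eq_iff_eq_univ _).1 (le_antisymm (Finset.card_le_univ _) ?_)
      rw [List.toFinset_card_of_nodup hp.support_nodup, Walk.length_support, hl]
      have hs : (Finset.univ : Finset V) ⊆ (Finset.range (k+1)).image f := by
        intro x _
        obtain ⟨i, hi, h⟩ := hc x
        exact Finset.mem_image.2 ⟨i, Finset.mem_range.2 hi, h⟩
      have := (Finset.card_le_card hs).trans Finset.card_image_le
      simpa using this
    intro x
    rw [← List.mem_toFinset, this]
    exact Finset.mem_univ x
  by_contra hlt
  obtain ⟨f, rfl, hf⟩ := h2 v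
  obtain ⟨j, hj, hx⟩ := CND.exj hconn h1 h3 ht hf (by omega)
  exact CND.core hconn h1 h2 h3 ht hf j hj hx
end

section
/- Let G be a CND graph (a finite connected simple graph with no hamiltonian path in which every vertex has detour order equal to τ(G)) of order n. Then the number of edges of G satisfies |E(G)| ≥ ⌈5n/4⌉. -/
open SimpleGraph

theorem exists_max_path {V : Type*} [Fintype V] (G : SimpleGraph V) (v : V)
    (hdet : vertexDetourOrder G v = detourOrder G) :
    ∃ (w : V) (p : G.Walk v w), p.IsPath ∧
      ∀ (a b : V) (q : G.Walk a b), q.IsPath → q.length ≤ p.length := by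
  have hb : BddAbove {n | ∃ (w : V) (p : G.Walk v w), p.IsPath ∧ n = p.length + 1} := by
    refine ⟨Fintype.card V, ?_⟩
    rintro n ⟨w, p, hp, rfl⟩
    exact hp.length_lt
  have hb2 : BddAbove {n | ∃ (u w : V) (p : G.Walk u w), p.IsPath ∧ n = p.length + 1} := by
    refine ⟨Fintype.card V, ?_⟩
    rintro n ⟨u, w, p, hp, rfl⟩
    exact hp.length_lt
  have hne : {n | ∃ (w : V) (p : G.Walk v w), p.IsPath ∧ n = p.length + 1}.Nonempty :=
    ⟨_, v, Walk.nil, Walk.IsPath.nil, rfl⟩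
  obtain ⟨w, p, hp, h⟩ := Nat.sSup_mem hne hb
  refine ⟨w, p, hp, fun a b q hq => ?_⟩
  have h1 : q.length + 1 ≤ detourOrder G := le_csSup hb2 ⟨a, b, q, hq, rfl⟩
  have h2 : vertexDetourOrder G v = p.length + 1 := h
  omega

theorem exists_boundary {V : Type*} (G : SimpleGraph V)
    (hconn : G.Connected) (hnt : ¬ Traceable G) {x w : V} (p : G.Walk x w) (hp : p.IsPath) :
    ∃ a b, a ∈ p.support ∧ b ∉ p.support ∧ G.Adj a b := by
  have : ∃ z, z ∉ p.support := by
    by_contra! h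
    exact hnt ⟨x, w, p, hp, h⟩
  obtain ⟨z, hz⟩ := this
  obtain ⟨q⟩ := hconn.preconnected x z
  obtain ⟨d, -, h1, h2⟩ := q.exists_boundary_dart {y | y ∈ p.support} p.start_mem_support hz
  exact ⟨d.fst, d.snd, h1, h2, d.adj⟩

theorem no_cycle {V : Type*} [DecidableEq V] (G : SimpleGraph V)
    (hconn : G.Connected) (hnt : ¬ Traceable G) {x w : V} (p : G.Walk x w) (hp : p.IsPath)
    (hmax : ∀ (a b : V) (q : G.Walk a b), q.IsPath → q.length ≤ p.length)
    (hadj : G.Adj w x) (he : s(w, x) ∉ p.edges) : False := by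
  obtain ⟨a, b, ha, hb, hab⟩ := exists_boundary G hconn hnt p hp
  have hc : (Walk.cons hadj p).IsCycle := (Walk.cons_isCycle_iff p hadj).2 ⟨hp, he⟩
  have ha' : a ∈ (Walk.cons hadj p).support := by simp [ha]
  have hc2 := (Walk.isCycle_rotate ha').2 hc
  have hlen := (Walk.cons hadj p).length_rotate a ha'
  have hsup : ∀ y ∈ ((Walk.cons hadj p).rotate a ha').support, y ∈ p.support := by
    intro y hy
    rw [Walk.mem_support_rotate_iff] at hy
    rw [Walk.support_cons, List.mem_cons] at hy
    rcases hy with rfl | hy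
    · exact p.end_mem_support
    · exact hy
  generalize (Walk.cons hadj p).rotate a ha' = c at hc2 hlen hsup
  cases c with
  | nil => simp at hc2
  | cons h q =>
    have hq := ((Walk.cons_isCycle_iff q h).1 hc2).1
    have hbq : b ∉ q.reverse.support := by
      intro hbq
      apply hb
      apply hsup
      rw [Walk.support_reverse, List.mem_reverse] at hbq
      simp [hbq]
    have := hmax _ _ (Walk.cons hab.symm q.reverse) ((Walk.cons_isPath_iff _ _).2 ⟨hq.reverse, hbq⟩)
    simp only [Walk.length_cons, Walk.length_reverse] at this hlen
    omega

theorem small_is_snd {V : Type*} [Fintype V] [DecidableEq V] (G : SimpleGraph V)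
    [DecidableRel G.Adj]
    (hconn : G.Connected) (hnt : ¬ Traceable G) {x w : V} (p : G.Walk x w) (hp : p.IsPath)
    (hmax : ∀ (a b : V) (q : G.Walk a b), q.IsPath → q.length ≤ p.length)
    (u : V) (hxu : G.Adj x u) (hdeg : G.degree u ≤ 2) : p.snd = u ∧ 1 ≤ p.length := by
  have hu : u ∈ p.support := by
    by_contra hu
    have := hmax _ _ (Walk.cons hxu.symm p) ((Walk.cons_isPath_iff _ _).2 ⟨hp, hu⟩)
    simp at this
  obtain ⟨i, hi, hil⟩ := Walk.mem_support_iff_exists_getVert.1 hu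
  have hi0 : i ≠ 0 := by
    rintro rfl
    rw [Walk.getVert_zero] at hi
    exact hxu.ne hi
  refine ⟨?_, by omega⟩
  by_contra hs
  have hi1 : i ≠ 1 := by
    rintro rfl
    exact hs hi
  have hinj := hp.getVert_injOn
  by_cases hl : i = p.length
  · have hw : u = w := by rw [← hi, hl, Walk.getVert_length]
    subst hw
    refine no_cycle G hconn hnt p hp hmax hxu.symm ?_
    intro h
    rw [Sym2.eq_swap] at h
    exact hs (hp.eq_snd_of_mem_edges h).symm
  · obtain ⟨j, rfl⟩ : ∃ j, i = j + 1 := ⟨i - 1, by omega⟩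
    have a1 : G.Adj u (p.getVert j) := by
      rw [← hi]; exact (p.adj_getVert_succ (by omega)).symm
    have a2 : G.Adj u (p.getVert (j + 2)) := by
      rw [← hi]; exact p.adj_getVert_succ (by omega)
    have n1 : x ≠ p.getVert j := by
      intro h
      have := hinj (x₁ := 0) (x₂ := j) (by simp) (by simp; omega) (by simpa using h)
      omega
    have n2 : x ≠ p.getVert (j + 2) := by
      intro h
      have := hinj (x₁ := 0) (x₂ := j + 2) (by simp) (by simp; omega) (by simpa using h)
      omega
    have n3 : p.getVert j ≠ p.getVert (j + 2) := by
      intro h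
      have := hinj (x₁ := j) (x₂ := j + 2) (by simp; omega) (by simp; omega) h
      omega
    have hsub : ({x, p.getVert j, p.getVert (j + 2)} : Finset V) ⊆ G.neighborFinset u := by
      intro y hy
      simp only [Finset.mem_insert, Finset.mem_singleton] at hy
      rw [mem_neighborFinset]
      rcases hy with rfl | rfl | rfl
      · exact hxu.symm
      · exact a1
      · exact a2
    have := Finset.card_le_card hsub
    rw [Finset.card_eq_three.2 ⟨_, _, _, n1, n2, n3, rfl⟩, card_neighborFinset_eq_degree] at this
    omega

theorem two_le_deg {V : Type*} [Fintype V] [DecidableEq V] (G : SimpleGraph V)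
    [DecidableRel G.Adj]
    (hconn : G.Connected) (hnt : ¬ Traceable G)
    (hdet : ∀ v : V, vertexDetourOrder G v = detourOrder G) (u : V) : 2 ≤ G.degree u := by
  by_contra! hd
  obtain ⟨a, b, ha, hb, hab⟩ := exists_boundary G hconn hnt (Walk.nil : G.Walk u u) Walk.IsPath.nil
  obtain rfl : a = u := by simpa using ha
  obtain ⟨w, p, hp, hmax⟩ := exists_max_path G b (hdet b)
  obtain ⟨hs, hl⟩ := small_is_snd G hconn hnt p hp hmax a hab.symm (by omega)
  have hs' : p.getVert 1 = a := hs
  by_cases h2 : 2 ≤ p.length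
  · have a2 : G.Adj a (p.getVert 2) := by
      rw [← hs']; exact p.adj_getVert_succ (by omega)
    have n2 : b ≠ p.getVert 2 := by
      intro h
      have := hp.getVert_injOn (x₁ := 0) (x₂ := 2) (by simp) (by simp; omega) (by simpa using h)
      omega
    have hsub : ({b, p.getVert 2} : Finset V) ⊆ G.neighborFinset a := by
      intro y hy
      simp only [Finset.mem_insert, Finset.mem_singleton] at hy
      rw [mem_neighborFinset]
      rcases hy with rfl | rfl
      · exact hab
      · exact a2
    have := Finset.card_le_card hsub
    rw [Finset.card_pair n2, card_neighborFinset_eq_degree] at this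
    omega
  · have hq : (Walk.cons hab (Walk.nil : G.Walk b b)).IsPath := by
      simp [hab.ne]
    obtain ⟨c, d, hc, hd', hcd⟩ := exists_boundary G hconn hnt _ hq
    simp only [Walk.support_cons, Walk.support_nil, List.mem_cons, List.not_mem_nil, or_false,
      not_or] at hc hd'
    rcases hc with rfl | rfl
    · have := hmax _ _ (Walk.cons hcd.symm (Walk.cons hab Walk.nil))
        (by simp [hab.ne, hd'.1, hd'.2])
      simp at this
      omega
    · have := hmax _ _ (Walk.cons hcd.symm (Walk.cons hab.symm Walk.nil))
        (by simp [hab.ne', hd'.1, hd'.2])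
      simp at this
      omega

theorem stmt_13 {V : Type*} [Fintype V] [DecidableEq V] (G : SimpleGraph V)
    [DecidableRel G.Adj]
    (hconn : G.Connected) (hnt : ¬ Traceable G)
    (hdet : ∀ v : V, vertexDetourOrder G v = detourOrder G) :
    (5 * Fintype.card V + 3) / 4 ≤ G.edgeFinset.card := by
  have hD := two_le_deg G hconn hnt hdet
  have huniq : ∀ x u u', G.Adj x u → G.Adj x u' → G.degree u = 2 → G.degree u' = 2 → u = u' := by
    intro x u u' h h' hu hu'
    obtain ⟨w, p, hp, hmax⟩ := exists_max_path G x (hdet x)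
    rw [← (small_is_snd G hconn hnt p hp hmax u h hu.le).1,
      ← (small_is_snd G hconn hnt p hp hmax u' h' hu'.le).1]
  have hex : ∀ u, ∃ y, G.degree u = 2 → G.Adj u y ∧ G.degree y ≠ 2 := by
    intro u
    by_cases hu : G.degree u = 2
    · rw [← card_neighborFinset_eq_degree, Finset.card_eq_two] at hu
      obtain ⟨y, z, hyz, h⟩ := hu
      have hy : G.Adj u y := by rw [← mem_neighborFinset, h]; simp
      have hz : G.Adj u z := by rw [← mem_neighborFinset, h]; simp
      by_cases hy2 : G.degree y = 2
      · exact ⟨z, fun _ => ⟨hz, fun hz2 => hyz (huniq u y z hy hz hy2 hz2)⟩⟩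
      · exact ⟨y, fun _ => ⟨hy, hy2⟩⟩
    · exact ⟨u, fun h => absurd h hu⟩
  choose f hf using hex
  have hcard : (Finset.univ.filter fun v => G.degree v = 2).card ≤
      (Finset.univ.filter fun v => ¬ G.degree v = 2).card := by
    refine Finset.card_le_card_of_injOn f ?_ ?_
    · intro u hu
      have hu : G.degree u = 2 := by simpa using hu
      simpa using (hf u hu).2
    · intro u hu v hv huv
      have hu : G.degree u = 2 := by simpa using hu
      have hv : G.degree v = 2 := by simpa using hv
      refine huniq (f u) u v (hf u hu).1.symm ?_ hu hv
      rw [huv]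
      exact (hf v hv).1.symm
  have htot := Finset.card_filter_add_card_filter_not (s := (Finset.univ : Finset V))
    (fun v => G.degree v = 2)
  rw [Finset.card_univ] at htot
  have hsum := G.sum_degrees_eq_twice_card_edges
  rw [← Finset.sum_filter_add_sum_filter_not _ (fun v => G.degree v = 2)] at hsum
  have h1 : (Finset.univ.filter fun v => G.degree v = 2).card * 2 ≤
      ∑ v ∈ Finset.univ.filter (fun v => G.degree v = 2), G.degree v := by
    rw [← smul_eq_mul]
    exact Finset.card_nsmul_le_sum _ _ _ (fun v _ => hD v)
  have h2 : (Finset.univ.filter fun v => ¬ G.degree v = 2).card * 3 ≤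
      ∑ v ∈ Finset.univ.filter (fun v => ¬ G.degree v = 2), G.degree v := by
    rw [← smul_eq_mul]
    refine Finset.card_nsmul_le_sum _ _ _ (fun v hv => ?_)
    have hv : G.degree v ≠ 2 := by simpa using hv
    have := hD v
    omega
  omega
end
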